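/- Let X be a connected n-dimensional complex manifold, Y a connected m-dimensional complex manifold, f(x, y) = (f_1, ..., f_n) holomorphic on X × Y, and suppose x* is an isolated solution of f(x, y*) = 0 of multiplicity μ for some y* ∈ Y. Then there exist open neighborhoods U of x* and V of y* such that for every y' ∈ V, the sum over all distinct points x' ∈ U with f(x', y') = 0 of dim_ℂ O_{X,x'} / J(f_1(x, y'), ..., f_n(x, y')) equals μ. -/

import Mathlib

set_option synthInstance.maxHeartbeats 1000000
set_option maxHeartbeats 1000000
open Filter Topology

noncomputable instance germAlgebra {α : Type*} (l : Filter α) : Algebra ℂ (Filter.Germ l ℂ) :=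
  ((Filter.Germ.coeRingHom l).comp (Pi.constRingHom α ℂ)).toAlgebra

variable {E : Type*} [NormedAddCommGroup E] [NormedSpace ℂ E]

/-- The local ring of germs at `p` of complex-analytic (holomorphic) functions,
    i.e. the ring of convergent power series centered at `p`. -/
noncomputable def analyticGermsAt (p : E) : Subalgebra ℂ (Filter.Germ (𝓝 p) ℂ) where
  carrier := {g | ∃ f : E → ℂ, AnalyticAt ℂ f p ∧ (f : Filter.Germ (𝓝 p) ℂ) = g}
  mul_mem' := by
    rintro a b ⟨f, hf, rfl⟩ ⟨g, hg, rfl⟩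
    exact ⟨f * g, hf.mul hg, rfl⟩
  add_mem' := by
    rintro a b ⟨f, hf, rfl⟩ ⟨g, hg, rfl⟩
    exact ⟨f + g, hf.add hg, rfl⟩
  algebraMap_mem' := fun r => ⟨fun _ => r, analyticAt_const, rfl⟩

/-- The multiplicity of a point `p` as a solution of the system `F k = 0`:
    the complex dimension of the quotient of the local ring of convergent power
    series at `p` by the ideal generated by the germs of the `F k`. -/
noncomputable def solMultiplicity {ι : Type*} (p : E) (F : ι → E → ℂ) : ℕ :=
  Module.finrank ℂ
    ((analyticGermsAt p) ⧸ Ideal.span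
      {g : analyticGermsAt p | ∃ k, (g : Filter.Germ (𝓝 p) ℂ) = ((F k : E → ℂ) : Filter.Germ (𝓝 p) ℂ)})


/-- The ideal, in the local ring of convergent power series at `p`, of germs of
    holomorphic functions vanishing on `Z` near `p`. -/
noncomputable def vanishingGermIdeal (Z : Set E) (p : E) : Ideal (analyticGermsAt p) where
  carrier := {g | ∃ f : E → ℂ, AnalyticAt ℂ f p ∧
    (f : Filter.Germ (𝓝 p) ℂ) = (g : Filter.Germ (𝓝 p) ℂ) ∧ ∀ᶠ x in 𝓝[Z] p, f x = 0}
  zero_mem' := ⟨fun _ => 0, analyticAt_const, rfl, Filter.Eventually.of_forall fun _ => rfl⟩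
  add_mem' := by
    rintro a b ⟨f, hf, hfe, hfz⟩ ⟨g, hg, hge, hgz⟩
    refine ⟨f + g, hf.add hg, ?_, ?_⟩
    · show (f : Filter.Germ (𝓝 p) ℂ) + g = _
      rw [hfe, hge]; rfl
    · filter_upwards [hfz, hgz] with x h1 h2
      simp [Pi.add_apply, h1, h2]
  smul_mem' := by
    rintro c g ⟨f, hf, hfe, hfz⟩
    obtain ⟨h, hh, hhe⟩ := c.2
    refine ⟨h * f, hh.mul hf, ?_, ?_⟩
    · show (h : Filter.Germ (𝓝 p) ℂ) * f = _
      rw [hfe, hhe]; rfl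
    · filter_upwards [hfz] with x h1
      simp [Pi.mul_apply, h1]

/-- The local dimension of a set `Z` at a point `p`: the Krull dimension of the
    quotient of the local ring of convergent power series at `p` by the ideal of
    germs vanishing on `Z`. -/
noncomputable def localDim (Z : Set E) (p : E) : WithBot (WithTop ℕ) :=
  ringKrullDim ((analyticGermsAt p) ⧸ vanishingGermIdeal Z p)

/-- `Z` is an analytic subset of the open set `Ω`: locally (at every point of `Ω`)
    it is the common zero set of finitely many holomorphic functions. -/
def IsAnalyticIn (Ω Z : Set E) : Prop :=
  Z ⊆ Ω ∧ ∀ p ∈ Ω, ∃ (U : Set E) (k : ℕ) (g : Fin k → E → ℂ),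
    IsOpen U ∧ p ∈ U ∧ U ⊆ Ω ∧ (∀ j, ∀ x ∈ U, AnalyticAt ℂ (g j) x) ∧
    Z ∩ U = {x ∈ U | ∀ j, g j x = 0}

/-- An irreducible analytic subset of `Ω`. -/
def IsIrreducibleAnalyticIn (Ω C : Set E) : Prop :=
  IsAnalyticIn Ω C ∧ C.Nonempty ∧
    ∀ C₁ C₂ : Set E, IsAnalyticIn Ω C₁ → IsAnalyticIn Ω C₂ →
      C ⊆ C₁ ∪ C₂ → C ⊆ C₁ ∨ C ⊆ C₂

/-- `C` is an irreducible component of the analytic set `Z` in `Ω`. -/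
def IsIrreducibleComponentOfAnalytic (Ω Z C : Set E) : Prop :=
  IsIrreducibleAnalyticIn Ω C ∧ C ⊆ Z ∧
    ∀ C' : Set E, IsIrreducibleAnalyticIn Ω C' → C ⊆ C' → C' ⊆ Z → C' = C

/-- A point `p` is an isolated point of the set `S`. -/
def IsIsolatedIn {α : Type*} [TopologicalSpace α] (S : Set α) (p : α) : Prop :=
  p ∈ S ∧ ∃ U : Set α, IsOpen U ∧ p ∈ U ∧ S ∩ U = {p}


section Germs

/-- The germ at `p` of a function analytic at `p`. -/
def toGerm (p : E) (f : E → ℂ) (hf : AnalyticAt ℂ f p) : analyticGermsAt p := ⟨f, f, hf, rfl⟩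

theorem exists_toGerm {p : E} (g : analyticGermsAt p) :
    ∃ (f : E → ℂ) (hf : AnalyticAt ℂ f p), g = toGerm p f hf := by
  obtain ⟨_, f, hf, rfl⟩ := g
  exact ⟨f, hf, rfl⟩

theorem toGerm_eq_iff {p : E} {f g : E → ℂ} {hf : AnalyticAt ℂ f p} {hg : AnalyticAt ℂ g p} :
    toGerm p f hf = toGerm p g hg ↔ f =ᶠ[𝓝 p] g := by
  rw [Subtype.ext_iff]
  exact Filter.Germ.coe_eq

theorem toGerm_add {p : E} {f g : E → ℂ} (hf : AnalyticAt ℂ f p) (hg : AnalyticAt ℂ g p) :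
    toGerm p f hf + toGerm p g hg = toGerm p (f + g) (hf.add hg) := rfl

theorem toGerm_sub {p : E} {f g : E → ℂ} (hf : AnalyticAt ℂ f p) (hg : AnalyticAt ℂ g p) :
    toGerm p f hf - toGerm p g hg = toGerm p (f - g) (hf.sub hg) := rfl

theorem toGerm_mul {p : E} {f g : E → ℂ} (hf : AnalyticAt ℂ f p) (hg : AnalyticAt ℂ g p) :
    toGerm p f hf * toGerm p g hg = toGerm p (f * g) (hf.mul hg) := rfl

/-- The value of a germ at its base point. -/
noncomputable def germValue (p : E) : analyticGermsAt p →+* ℂ :=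
  (Filter.Germ.valueRingHom (X := E) (x := p)).comp (analyticGermsAt p).val.toRingHom

theorem germValue_toGerm {p : E} {f : E → ℂ} (hf : AnalyticAt ℂ f p) :
    germValue p (toGerm p f hf) = f p := rfl

theorem algebraMap_germ (p : E) (c : ℂ) :
    algebraMap ℂ (analyticGermsAt p) c = toGerm p (fun _ => c) analyticAt_const := rfl

theorem germValue_algebraMap (p : E) (c : ℂ) :
    germValue p (algebraMap ℂ (analyticGermsAt p) c) = c := rfl

/-- The maximal ideal of the ring of germs. -/
noncomputable def germMax (p : E) : Ideal (analyticGermsAt p) := RingHom.ker (germValue p)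

theorem isUnit_germ {p : E} {g : analyticGermsAt p} (h : germValue p g ≠ 0) : IsUnit g := by
  obtain ⟨f, hf, rfl⟩ := exists_toGerm g
  rw [germValue_toGerm] at h
  refine IsUnit.of_mul_eq_one (toGerm p f⁻¹ (hf.inv h)) ?_
  rw [toGerm_mul]
  change _ = toGerm p (fun _ => 1) analyticAt_const
  rw [toGerm_eq_iff]
  filter_upwards [hf.continuousAt.eventually_ne h] with x hx
  simp [hx]

theorem germMax_le_jacobson (p : E) : germMax p ≤ Ideal.jacobson ⊥ := by
  intro g hg
  rw [Ideal.mem_jacobson_bot]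
  intro y
  apply isUnit_germ
  rw [map_add, map_mul, RingHom.mem_ker.1 hg]
  simp

theorem solIdeal_eq {ι : Type*} {p : E} {F : ι → E → ℂ} (hF : ∀ k, AnalyticAt ℂ (F k) p) :
    {g : analyticGermsAt p | ∃ k, (g : Filter.Germ (𝓝 p) ℂ) = ((F k : E → ℂ) : Filter.Germ (𝓝 p) ℂ)}
      = Set.range fun k => toGerm p (F k) (hF k) := by
  ext g
  simp only [Set.mem_ofPred_eq, Set.mem_range, Subtype.ext_iff]
  exact ⟨fun ⟨k, hk⟩ => ⟨k, hk.symm⟩, fun ⟨k, hk⟩ => ⟨k, hk.symm⟩⟩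

/-- The ideal generated by the germs at `p` of the functions `F k`. -/
noncomputable def solIdeal {ι : Type*} (p : E) (F : ι → E → ℂ) : Ideal (analyticGermsAt p) :=
  Ideal.span {g : analyticGermsAt p |
    ∃ k, (g : Filter.Germ (𝓝 p) ℂ) = ((F k : E → ℂ) : Filter.Germ (𝓝 p) ℂ)}

theorem solMultiplicity_eq {ι : Type*} (p : E) (F : ι → E → ℂ) :
    solMultiplicity p F = Module.finrank ℂ (analyticGermsAt p ⧸ solIdeal p F) := rfl

theorem solIdeal_le_germMax {ι : Type*} {p : E} {F : ι → E → ℂ} (h : ∀ k, F k p = 0) :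
    solIdeal p F ≤ germMax p := by
  refine Ideal.span_le.2 ?_
  rintro ⟨g, hg⟩ ⟨k, rfl⟩
  exact h k

theorem one_le_solMultiplicity {ι : Type*} {p : E} {F : ι → E → ℂ} (h : ∀ k, F k p = 0)
    (hfin : Module.Finite ℂ (analyticGermsAt p ⧸ solIdeal p F)) : 1 ≤ solMultiplicity p F := by
  rw [solMultiplicity_eq, Nat.one_le_iff_ne_zero]
  have : Nontrivial (analyticGermsAt p ⧸ solIdeal p F) := by
    rw [Ideal.Quotient.nontrivial_iff]
    intro htop
    have h1 := solIdeal_le_germMax h (htop ▸ Submodule.mem_top : (1 : analyticGermsAt p) ∈ _)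
    rw [germMax, RingHom.mem_ker, map_one] at h1
    exact one_ne_zero h1
  exact Module.finrank_pos.ne'

/-- In a finite-dimensional quotient of dimension at most `d`, the `d`-th power of an ideal
contained in the Jacobson radical vanishes. -/
theorem pow_le_of_finrank_le {K A : Type*} [Field K] [CommRing A] [Algebra K A] {M J : Ideal A}
    (hM : M ≤ Ideal.jacobson ⊥) (hfin : Module.Finite K (A ⧸ J)) {d : ℕ}
    (hd : Module.finrank K (A ⧸ J) ≤ d) : M ^ d ≤ J := by
  let B := A ⧸ J
  let M' : Ideal B := M.map (Ideal.Quotient.mk J)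
  have hM' : M' ≤ Ideal.jacobson ⊥ := by
    refine Ideal.map_le_iff_le_comap.2 fun a ha => ?_
    rw [Ideal.mem_comap, Ideal.mem_jacobson_bot]
    intro y
    obtain ⟨y, rfl⟩ := Ideal.Quotient.mk_surjective y
    rw [← map_mul, ← map_one (Ideal.Quotient.mk J), ← map_add]
    exact (Ideal.mem_jacobson_bot.1 (hM ha) y).map _
  have : IsNoetherian K B := inferInstance
  have hN : IsNoetherianRing B := isNoetherian_of_tower K this
  have key : ∀ j, Module.finrank K ((M' ^ j).restrictScalars K) + j ≤ Module.finrank K B ∨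
      M' ^ j = ⊥ := by
    intro j
    induction j with
    | zero => left; simpa using Submodule.finrank_le _
    | succ j ih =>
      by_cases h : M' ^ j = ⊥
      · right; rw [pow_succ, h, Ideal.bot_mul]
      · left
        have ih := ih.resolve_right h
        have hlt : (M' ^ (j + 1)).restrictScalars K < (M' ^ j).restrictScalars K := by
          refine lt_of_le_of_ne (fun x hx => Ideal.pow_le_pow_right (Nat.le_succ j) hx) fun he => h ?_
          have he' : M' ^ (j + 1) = M' ^ j := Submodule.restrictScalars_injective K B B he
          refine Submodule.eq_bot_of_le_smul_of_le_jacobson_bot M' _ (IsNoetherian.noetherian _) ?_ hM'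
          rw [smul_eq_mul, ← pow_succ', he']
        have := Submodule.finrank_lt_finrank_of_lt hlt
        omega
  have h0 : M' ^ d = ⊥ := by
    rcases key d with h | h
    · have h1 : Module.finrank K ((M' ^ d).restrictScalars K) = 0 := by
        have : Module.finrank K B ≤ d := hd
        omega
      have h2 := Submodule.finrank_eq_zero.1 h1
      exact (Submodule.restrictScalars_eq_bot_iff K B B).1 h2
    · exact h
  rw [← Ideal.map_pow, Ideal.map_eq_bot_iff_le_ker, Ideal.mk_ker] at h0
  exact h0

theorem Ideal.span_range_eq_of_sub_mem {A ι : Type*} [CommRing A] [Finite ι] {M : Ideal A}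
    (hM : M ≤ Ideal.jacobson ⊥) {a b : ι → A} {k : ℕ} (h : M ^ k ≤ Ideal.span (Set.range a))
    (hab : ∀ i, a i - b i ∈ M ^ (k + 1)) : Ideal.span (Set.range b) = Ideal.span (Set.range a) := by
  apply le_antisymm
  · refine Ideal.span_le.2 ?_
    rintro _ ⟨i, rfl⟩
    have h1 : a i ∈ Ideal.span (Set.range a) := Ideal.subset_span ⟨i, rfl⟩
    have h2 := h (Ideal.pow_le_pow_right (Nat.le_succ k) (hab i))
    simpa using sub_mem h1 h2
  · refine Submodule.le_of_le_smul_of_le_jacobson_bot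
      (Submodule.fg_span (Set.finite_range a)) hM (Submodule.span_le.2 ?_)
    rintro _ ⟨i, rfl⟩
    have h1 : b i ∈ Ideal.span (Set.range b) := Ideal.subset_span ⟨i, rfl⟩
    have h2 : a i - b i ∈ M • Ideal.span (Set.range a) := by
      have := hab i
      rw [pow_succ'] at this
      exact Ideal.mul_mono_right h this
    have := add_mem (Submodule.mem_sup_left h1 : _ ∈ _ ⊔ M • Ideal.span (Set.range a))
      (Submodule.mem_sup_right h2)
    simpa using this

end Germs

section PolynomialSystems

open MvPolynomial

section PhamAlgebra

variable {σ R : Type*} [CommRing R]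

/-- Polynomials all of whose monomials have total degree `< d`. -/
def degLT (σ R : Type*) [CommRing R] (d : ℕ) : Submodule R (MvPolynomial σ R) where
  carrier := {p | ∀ m : σ →₀ ℕ, d ≤ m.degree → coeff m p = 0}
  add_mem' ha hb m hm := by simp [ha m hm, hb m hm]
  zero_mem' m _ := by simp
  smul_mem' c p hp m hm := by simp [hp m hm]

theorem degLT_mono {d e : ℕ} (h : d ≤ e) : degLT σ R d ≤ degLT σ R e :=
  fun _ hp m hm => hp m (h.trans hm)

theorem mul_mem_degLT {d e : ℕ} {p q : MvPolynomial σ R} (hp : p ∈ degLT σ R (d + 1))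
    (hq : q ∈ degLT σ R e) : p * q ∈ degLT σ R (d + e) := by
  classical
  intro m hm
  rw [coeff_mul]
  refine Finset.sum_eq_zero fun x hx => ?_
  have hx := Finset.HasAntidiagonal.mem_antidiagonal.1 hx
  have hd : x.1.degree + x.2.degree = m.degree := by rw [← hx, map_add]
  by_cases h : d + 1 ≤ x.1.degree
  · rw [hp _ h, zero_mul]
  · rw [hq _ (by omega), mul_zero]

theorem monomial_mem_degLT {γ : σ →₀ ℕ} {d : ℕ} (h : γ.degree < d) (c : R) :
    monomial γ c ∈ degLT σ R d := by
  classical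
  intro m hm
  rw [coeff_monomial, if_neg]
  rintro rfl
  omega

/-- `a` is the monomial `x ^ γ` plus terms of lower total degree. -/
def HasLead (a : MvPolynomial σ R) (γ : σ →₀ ℕ) : Prop :=
  a - monomial γ 1 ∈ degLT σ R γ.degree

theorem HasLead.mem {a : MvPolynomial σ R} {γ : σ →₀ ℕ} (h : HasLead a γ) :
    a ∈ degLT σ R (γ.degree + 1) := by
  have := add_mem (degLT_mono (Nat.le_succ _) h)
    (monomial_mem_degLT (Nat.lt_succ_self γ.degree) (1 : R))
  simpa using this

theorem HasLead.monomial (γ : σ →₀ ℕ) : HasLead (monomial γ (1 : R)) γ := by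
  simp [HasLead]

theorem HasLead.mul {a b : MvPolynomial σ R} {γ δ : σ →₀ ℕ} (ha : HasLead a γ)
    (hb : HasLead b δ) : HasLead (a * b) (γ + δ) := by
  have h1 := mul_mem_degLT ha.mem hb
  have h2 := mul_mem_degLT (monomial_mem_degLT (Nat.lt_succ_self δ.degree) (1 : R)) ha
  have h3 := add_mem h1 ((add_comm δ.degree γ.degree) ▸ h2)
  unfold HasLead
  rw [map_add]
  convert h3 using 1
  have : MvPolynomial.monomial (γ + δ) (1 : R)
    = MvPolynomial.monomial γ 1 * MvPolynomial.monomial δ 1 := by simp [monomial_mul]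
  rw [this]
  ring

theorem HasLead.one : HasLead (1 : MvPolynomial σ R) 0 := HasLead.monomial 0

theorem HasLead.pow {a : MvPolynomial σ R} {γ : σ →₀ ℕ} (ha : HasLead a γ) (k : ℕ) :
    HasLead (a ^ k) (k • γ) := by
  induction k with
  | zero => simpa using HasLead.one
  | succ k ih => rw [pow_succ, succ_nsmul]; exact ih.mul ha

theorem HasLead.prod {ι : Type*} (s : Finset ι) {a : ι → MvPolynomial σ R} {γ : ι → σ →₀ ℕ}
    (h : ∀ i, HasLead (a i) (γ i)) : HasLead (∏ i ∈ s, a i) (∑ i ∈ s, γ i) := by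
  classical
  induction s using Finset.induction_on with
  | empty => simpa using HasLead.one
  | insert i s hi ih => rw [Finset.prod_insert hi, Finset.sum_insert hi]; exact (h i).mul ih

/-- A system `P i = X i ^ D + (terms of total degree < D)`. -/
def IsPham (D : ℕ) (P : σ → MvPolynomial σ R) : Prop :=
  ∀ i, HasLead (P i) (Finsupp.single i D)

theorem monomial_eq_smul (γ : σ →₀ ℕ) (c : R) :
    monomial γ c = c • monomial γ (1 : R) := by simp [smul_monomial]

theorem mem_degLT_induction {d : ℕ} {M : Submodule R (MvPolynomial σ R)}
    (h : ∀ γ : σ →₀ ℕ, γ.degree < d → monomial γ (1 : R) ∈ M) : degLT σ R d ≤ M := by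
  intro p hp
  rw [p.as_sum]
  refine M.sum_mem fun γ hγ => ?_
  rw [monomial_eq_smul]
  refine M.smul_mem _ (h γ ?_)
  by_contra hc
  exact (mem_support_iff.1 hγ) (hp γ (not_lt.1 hc))

theorem exists_mem_degLT (p : MvPolynomial σ R) : ∃ d, p ∈ degLT σ R d := by
  refine ⟨p.support.sup Finsupp.degree + 1, fun m hm => ?_⟩
  by_contra hc
  have := Finset.le_sup (f := Finsupp.degree) (mem_support_iff.2 hc)
  omega

variable [Fintype σ]

/-- The product of powers of the `P i` and of the coordinates with leading monomial `x ^ γ`. -/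
noncomputable def phamMonomial (D : ℕ) (P : σ → MvPolynomial σ R) (γ : σ →₀ ℕ) :
    MvPolynomial σ R :=
  ∏ i, P i ^ (γ i / D) * X i ^ (γ i % D)

theorem IsPham.hasLead {D : ℕ} {P : σ → MvPolynomial σ R} (hP : IsPham D P) (γ : σ →₀ ℕ) :
    HasLead (phamMonomial D P γ) γ := by
  classical
  have h : ∀ i, HasLead (P i ^ (γ i / D) * X i ^ (γ i % D)) (Finsupp.single i (γ i)) := by
    intro i
    have hX : HasLead (X i : MvPolynomial σ R) (Finsupp.single i 1) := HasLead.monomial _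
    have := ((hP i).pow (γ i / D)).mul (hX.pow (γ i % D))
    convert this using 1
    simp only [Finsupp.smul_single, smul_eq_mul, mul_one, ← Finsupp.single_add]
    rw [mul_comm, Nat.div_add_mod]
  have := HasLead.prod Finset.univ h
  rwa [Finsupp.univ_sum_single] at this

/-- The linear endomorphism `x ^ γ ↦ phamMonomial D P γ`. -/
noncomputable def phamMap (D : ℕ) (P : σ → MvPolynomial σ R) :
    MvPolynomial σ R →ₗ[R] MvPolynomial σ R :=
  (basisMonomials σ R).constr R (phamMonomial D P)

theorem phamMap_monomial (D : ℕ) (P : σ → MvPolynomial σ R) (γ : σ →₀ ℕ) :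
    phamMap D P (monomial γ 1) = phamMonomial D P γ := by
  have := (basisMonomials σ R).constr_basis R (phamMonomial D P) γ
  simpa [phamMap] using this

theorem IsPham.map_sub_mem {D : ℕ} {P : σ → MvPolynomial σ R} (hP : IsPham D P) {d : ℕ}
    {g : MvPolynomial σ R} (hg : g ∈ degLT σ R (d + 1)) : phamMap D P g - g ∈ degLT σ R d := by
  have : degLT σ R (d + 1) ≤ (degLT σ R d).comap (phamMap D P - LinearMap.id) := by
    refine mem_degLT_induction fun γ hγ => ?_
    rw [Submodule.mem_comap, LinearMap.sub_apply, phamMap_monomial]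
    exact degLT_mono (by omega) (hP.hasLead γ)
  exact this hg

theorem IsPham.injective {D : ℕ} {P : σ → MvPolynomial σ R} (hP : IsPham D P) :
    Function.Injective (phamMap D P) := by
  rw [← LinearMap.ker_eq_bot, eq_bot_iff]
  intro g hg
  rw [LinearMap.mem_ker] at hg
  obtain ⟨d, hd⟩ := exists_mem_degLT g
  induction d with
  | zero => ext m; simpa using hd m (Nat.zero_le _)
  | succ d ih =>
    have := hP.map_sub_mem hd
    rw [hg, zero_sub] at this
    exact ih (by simpa using (degLT σ R d).neg_mem this)

theorem IsPham.surjective {D : ℕ} {P : σ → MvPolynomial σ R} (hP : IsPham D P) :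
    Function.Surjective (phamMap D P) := by
  have key : ∀ d, degLT σ R d ≤ LinearMap.range (phamMap D P) := by
    intro d
    induction d with
    | zero =>
      intro g hg
      have : g = 0 := by ext m; simpa using hg m (Nat.zero_le _)
      rw [this]; exact zero_mem _
    | succ d ih =>
      intro g hg
      have h1 := ih (hP.map_sub_mem hg)
      have h2 : phamMap D P g ∈ LinearMap.range (phamMap D P) := ⟨g, rfl⟩
      simpa using sub_mem h2 h1
  intro g
  obtain ⟨d, hd⟩ := exists_mem_degLT g
  exact key d hd

/-- `phamMap` as a linear automorphism. -/
noncomputable def IsPham.equiv {D : ℕ} {P : σ → MvPolynomial σ R} (hP : IsPham D P) :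
    MvPolynomial σ R ≃ₗ[R] MvPolynomial σ R :=
  LinearEquiv.ofBijective (phamMap D P) ⟨hP.injective, hP.surjective⟩

theorem IsPham.equiv_monomial {D : ℕ} {P : σ → MvPolynomial σ R} (hP : IsPham D P)
    (γ : σ →₀ ℕ) : hP.equiv (monomial γ 1) = phamMonomial D P γ :=
  phamMap_monomial D P γ

theorem phamMonomial_add_single {D : ℕ} (hD : 0 < D) (P : σ → MvPolynomial σ R) (γ : σ →₀ ℕ)
    (i : σ) : phamMonomial D P (γ + Finsupp.single i D) = P i * phamMonomial D P γ := by
  classical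
  unfold phamMonomial
  rw [← Finset.mul_prod_erase _ _ (Finset.mem_univ i),
    ← Finset.mul_prod_erase (a := i) _ (fun i => P i ^ (γ i / D) * X i ^ (γ i % D))
      (Finset.mem_univ i), ← mul_assoc]
  congr 1
  · simp [Nat.add_div_right _ hD, pow_succ']
    ring
  · refine Finset.prod_congr rfl fun j hj => ?_
    rw [Finsupp.add_apply, Finsupp.single_eq_of_ne (Finset.ne_of_mem_erase hj), add_zero]

/-- The exponent attached to a point of the box `[0, D) ^ σ`. -/
noncomputable def boxExp {D : ℕ} (β : σ → Fin D) : σ →₀ ℕ :=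
  Finsupp.equivFunOnFinite.symm fun i => (β i : ℕ)

theorem phamMonomial_boxExp {D : ℕ} (P : σ → MvPolynomial σ R) (β : σ → Fin D) :
    phamMonomial D P (boxExp β) = monomial (boxExp β) 1 := by
  rw [monomial_eq, Finsupp.prod_fintype _ _ (by simp)]
  simp [phamMonomial, boxExp, Nat.div_eq_of_lt, Nat.mod_eq_of_lt]

/-- Coordinates of the normal form modulo the ideal generated by the `P i`. -/
noncomputable def IsPham.normalForm {D : ℕ} {P : σ → MvPolynomial σ R} (hP : IsPham D P) :
    MvPolynomial σ R →ₗ[R] ((σ → Fin D) → R) :=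
  LinearMap.pi fun β => (lcoeff R (boxExp β)).comp hP.equiv.symm.toLinearMap

theorem IsPham.normalForm_apply {D : ℕ} {P : σ → MvPolynomial σ R} (hP : IsPham D P)
    (g : MvPolynomial σ R) (β : σ → Fin D) :
    hP.normalForm g β = coeff (boxExp β) (hP.equiv.symm g) := rfl

theorem boxExp_injective {D : ℕ} : Function.Injective (boxExp : (σ → Fin D) → σ →₀ ℕ) := by
  intro a b h
  funext i
  exact Fin.ext (by simpa [boxExp] using DFunLike.congr_fun h i)

theorem IsPham.normalForm_boxExp [DecidableEq σ] {D : ℕ} {P : σ → MvPolynomial σ R}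
    (hP : IsPham D P) (β : σ → Fin D) :
    hP.normalForm (monomial (boxExp β) 1) = Pi.single β 1 := by
  classical
  funext β'
  have : hP.equiv.symm (monomial (boxExp β) 1) = monomial (boxExp β) 1 := by
    rw [LinearEquiv.symm_apply_eq, hP.equiv_monomial, phamMonomial_boxExp]
  rw [hP.normalForm_apply, this, coeff_monomial, Pi.single_apply]
  simp [boxExp_injective.eq_iff, eq_comm]

theorem IsPham.normalForm_surjective {D : ℕ} {P : σ → MvPolynomial σ R} (hP : IsPham D P) :
    Function.Surjective hP.normalForm := by
  classical
  intro v
  refine ⟨∑ β, v β • monomial (boxExp β) 1, ?_⟩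
  simp only [map_sum, map_smul, hP.normalForm_boxExp]
  funext β
  simp [Pi.single_apply]

theorem IsPham.ker_normalForm {D : ℕ} (hD : 0 < D) {P : σ → MvPolynomial σ R}
    (hP : IsPham D P) :
    LinearMap.ker hP.normalForm = (Ideal.span (Set.range P)).restrictScalars R := by
  classical
  apply le_antisymm
  · intro g hg
    obtain ⟨h, rfl⟩ := hP.equiv.surjective g
    rw [Submodule.restrictScalars_mem, h.as_sum, map_sum]
    refine Ideal.sum_mem _ fun γ hγ => ?_
    rw [monomial_eq_smul, map_smul, hP.equiv_monomial, smul_eq_C_mul]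
    refine Ideal.mul_mem_left _ _ ?_
    have : ∃ i, D ≤ γ i := by
      by_contra! hc
      have h1 := congrFun (LinearMap.mem_ker.1 hg) (fun i => ⟨γ i, hc i⟩)
      rw [hP.normalForm_apply, LinearEquiv.symm_apply_apply] at h1
      refine (mem_support_iff.1 hγ) ?_
      have h2 : boxExp (fun i => (⟨γ i, hc i⟩ : Fin D)) = γ := by ext i; simp [boxExp]
      rwa [h2] at h1
    obtain ⟨i, hi⟩ := this
    have h2 : γ = (γ - Finsupp.single i D) + Finsupp.single i D := by
      rw [tsub_add_cancel_of_le]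
      simpa using hi
    rw [h2, phamMonomial_add_single hD]
    exact Ideal.mul_mem_right _ _ (Ideal.subset_span ⟨i, rfl⟩)
  · intro g hg
    rw [Submodule.restrictScalars_mem] at hg
    obtain ⟨c, rfl⟩ := Ideal.mem_span_range_iff_exists_fun.1 hg
    rw [LinearMap.mem_ker, map_sum]
    refine Finset.sum_eq_zero fun i _ => ?_
    have key : (hP.normalForm.comp (LinearMap.mulLeft R (P i))).comp
        hP.equiv.toLinearMap = 0 := by
      refine (basisMonomials σ R).ext fun γ => ?_
      rw [coe_basisMonomials]
      simp only [LinearMap.comp_apply, LinearEquiv.coe_coe, hP.equiv_monomial,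
        LinearMap.mulLeft_apply, LinearMap.zero_apply]
      rw [← phamMonomial_add_single hD, ← hP.equiv_monomial]
      funext β
      rw [hP.normalForm_apply, LinearEquiv.symm_apply_apply, coeff_monomial, if_neg]
      · rfl
      · intro h
        have := DFunLike.congr_fun h i
        have h3 := (β i).2
        simp [boxExp] at this
        omega
    have h4 := LinearMap.congr_fun key (hP.equiv.symm (c i))
    simpa [mul_comm] using h4

open Classical in
/-- The diagonal sum computing the trace of the multiplication by `h` on the quotient by the
ideal generated by the `P i`. -/
noncomputable def IsPham.traceNF {D : ℕ} {P : σ → MvPolynomial σ R} (hP : IsPham D P)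
    (h : MvPolynomial σ R) : R :=
  ∑ β, hP.normalForm (h * monomial (boxExp β) 1) β

section Map

variable {R' : Type*} [CommRing R'] (φ : R →+* R')

omit [Fintype σ] in
theorem HasLead.map {a : MvPolynomial σ R} {γ : σ →₀ ℕ} (h : HasLead a γ) :
    HasLead (MvPolynomial.map φ a) γ := by
  intro m hm
  have := congrArg φ (h m hm)
  simpa [← coeff_map] using this

omit [Fintype σ] in
theorem IsPham.map {D : ℕ} {P : σ → MvPolynomial σ R} (hP : IsPham D P) :
    IsPham D fun i => MvPolynomial.map φ (P i) := fun i => (hP i).map φ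

theorem IsPham.map_equiv {D : ℕ} {P : σ → MvPolynomial σ R} (hP : IsPham D P)
    (g : MvPolynomial σ R) :
    MvPolynomial.map φ (hP.equiv g) = (hP.map φ).equiv (MvPolynomial.map φ g) := by
  rw [g.as_sum]
  simp only [map_sum]
  refine Finset.sum_congr rfl fun γ _ => ?_
  rw [monomial_eq_smul γ, map_smul, hP.equiv_monomial, smul_eq_C_mul, smul_eq_C_mul, map_mul,
    map_mul, map_C, map_monomial, map_one, ← smul_eq_C_mul, ← smul_eq_C_mul, map_smul,
    (hP.map φ).equiv_monomial]
  simp [phamMonomial]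

theorem IsPham.map_normalForm {D : ℕ} {P : σ → MvPolynomial σ R} (hP : IsPham D P)
    (g : MvPolynomial σ R) (β : σ → Fin D) :
    φ (hP.normalForm g β) = (hP.map φ).normalForm (MvPolynomial.map φ g) β := by
  rw [hP.normalForm_apply, (hP.map φ).normalForm_apply, ← coeff_map]
  congr 1
  rw [LinearEquiv.eq_symm_apply, ← hP.map_equiv, LinearEquiv.apply_symm_apply]

theorem IsPham.map_traceNF {D : ℕ} {P : σ → MvPolynomial σ R} (hP : IsPham D P)
    (h : MvPolynomial σ R) :
    φ (hP.traceNF h) = (hP.map φ).traceNF (MvPolynomial.map φ h) := by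
  simp [traceNF, hP.map_normalForm φ]

end Map

end PhamAlgebra

section PhamTrace

variable {σ K : Type*} [Field K] [Fintype σ]

/-- The quotient by the ideal of a Pham system, in normal form coordinates. -/
noncomputable def IsPham.quotEquiv {D : ℕ} (hD : 0 < D) {P : σ → MvPolynomial σ K}
    (hP : IsPham D P) :
    (MvPolynomial σ K ⧸ Ideal.span (Set.range P)) ≃ₗ[K] ((σ → Fin D) → K) :=
  (Submodule.Quotient.restrictScalarsEquiv K (Ideal.span (Set.range P))).symm ≪≫ₗ
    (Submodule.quotEquivOfEq _ _ (hP.ker_normalForm hD).symm) ≪≫ₗ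
    hP.normalForm.quotKerEquivOfSurjective hP.normalForm_surjective

theorem IsPham.quotEquiv_mk {D : ℕ} (hD : 0 < D) {P : σ → MvPolynomial σ K}
    (hP : IsPham D P) (g : MvPolynomial σ K) :
    hP.quotEquiv hD (Ideal.Quotient.mk _ g) = hP.normalForm g := rfl

theorem IsPham.finite_quotient {D : ℕ} (hD : 0 < D) {P : σ → MvPolynomial σ K}
    (hP : IsPham D P) : Module.Finite K (MvPolynomial σ K ⧸ Ideal.span (Set.range P)) :=
  Module.Finite.equiv (hP.quotEquiv hD).symm

theorem IsPham.trace_eq {D : ℕ} (hD : 0 < D) {P : σ → MvPolynomial σ K}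
    (hP : IsPham D P) (h : MvPolynomial σ K) :
    Algebra.trace K (MvPolynomial σ K ⧸ Ideal.span (Set.range P)) (Ideal.Quotient.mk _ h)
      = hP.traceNF h := by
  classical
  rw [Algebra.trace_apply, LinearMap.trace_eq_matrix_trace K
    (Module.Basis.ofEquivFun (hP.quotEquiv hD)), Matrix.trace]
  unfold IsPham.traceNF
  refine Finset.sum_congr rfl fun β _ => ?_
  rw [Matrix.diag_apply, LinearMap.toMatrix_apply, Module.Basis.ofEquivFun_repr_apply]
  have : Module.Basis.ofEquivFun (hP.quotEquiv hD) β
      = Ideal.Quotient.mk _ (monomial (boxExp β) 1) := by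
    apply (hP.quotEquiv hD).injective
    rw [hP.quotEquiv_mk, hP.normalForm_boxExp]
    simp
  rw [this]
  rw [Algebra.coe_lmul_eq_mul, LinearMap.mul_apply', ← map_mul]
  exact congrFun (hP.quotEquiv_mk hD _) β

end PhamTrace

section PolyGerms

variable {σ : Type*} [Fintype σ]

theorem analyticAt_eval (p : MvPolynomial σ ℂ) (z : σ → ℂ) :
    AnalyticAt ℂ (fun x => eval x p) z := AnalyticOnNhd.eval_mvPolynomial p z (Set.mem_univ z)

theorem continuous_eval_mvPolynomial (p : MvPolynomial σ ℂ) :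
    Continuous fun x : σ → ℂ => eval x p :=
  continuous_iff_continuousAt.2 fun z => (analyticAt_eval p z).continuousAt

/-- The germ of a polynomial function. -/
noncomputable def polyGerm (z : σ → ℂ) : MvPolynomial σ ℂ →+* analyticGermsAt z where
  toFun p := toGerm z (fun x => eval x p) (analyticAt_eval p z)
  map_one' := by
    change _ = toGerm z (fun _ => 1) analyticAt_const
    simp
  map_zero' := by
    change _ = toGerm z (fun _ => 0) analyticAt_const
    simp
  map_add' p q := by
    rw [toGerm_add, toGerm_eq_iff]
    exact Eventually.of_forall fun x => by simp
  map_mul' p q := by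
    rw [toGerm_mul, toGerm_eq_iff]
    exact Eventually.of_forall fun x => by simp

theorem polyGerm_apply (z : σ → ℂ) (p : MvPolynomial σ ℂ) :
    polyGerm z p = toGerm z (fun x => eval x p) (analyticAt_eval p z) := rfl

theorem polyGerm_C (z : σ → ℂ) (c : ℂ) : polyGerm z (C c) = algebraMap ℂ _ c := by
  rw [algebraMap_germ, polyGerm_apply, toGerm_eq_iff]
  simp

theorem germValue_polyGerm (z : σ → ℂ) (p : MvPolynomial σ ℂ) :
    germValue z (polyGerm z p) = eval z p := rfl

/-- The ideal of polynomials generated by the `X i - z i`. -/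
noncomputable def pointIdeal (z : σ → ℂ) : Ideal (MvPolynomial σ ℂ) :=
  Ideal.span (Set.range fun i => X i - C (z i))

omit [Fintype σ] in
theorem X_sub_C_mem_pointIdeal (z : σ → ℂ) (i : σ) : X i - C (z i) ∈ pointIdeal z :=
  Ideal.subset_span ⟨i, rfl⟩

omit [Fintype σ] in
theorem sub_C_eval_mem_pointIdeal (z : σ → ℂ) (p : MvPolynomial σ ℂ) :
    p - C (eval z p) ∈ pointIdeal z := by
  induction p using MvPolynomial.induction_on with
  | C a => simp
  | add p q hp hq => 
    have := add_mem hp hq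
    convert this using 1
    simp; ring
  | mul_X p i hp =>
    have := add_mem (Ideal.mul_mem_right (X i) _ hp)
      (Ideal.mul_mem_left _ (C (eval z p)) (X_sub_C_mem_pointIdeal z i))
    convert this using 1
    simp; ring

omit [Fintype σ] in
theorem eval_eq_zero_of_mem_pointIdeal {z : σ → ℂ} {p : MvPolynomial σ ℂ}
    (h : p ∈ pointIdeal z) : eval z p = 0 := by
  have : pointIdeal z ≤ RingHom.ker (eval z) := by
    refine Ideal.span_le.2 ?_
    rintro _ ⟨i, rfl⟩
    simp [RingHom.mem_ker]
  exact this h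

omit [Fintype σ] in
theorem isCoprime_pointIdeal {z w : σ → ℂ} (h : z ≠ w) :
    IsCoprime (pointIdeal z) (pointIdeal w) := by
  obtain ⟨i, hi⟩ := Function.ne_iff.1 h
  rw [Ideal.isCoprime_iff_exists]
  have hne : w i - z i ≠ 0 := sub_ne_zero.2 hi.symm
  refine ⟨C (w i - z i)⁻¹ * (X i - C (z i)),
    Ideal.mul_mem_left _ _ (X_sub_C_mem_pointIdeal z i),
    -(C (w i - z i)⁻¹ * (X i - C (w i))),
    neg_mem (Ideal.mul_mem_left _ _ (X_sub_C_mem_pointIdeal w i)), ?_⟩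
  have : C (w i - z i)⁻¹ * (X i - C (z i)) + -(C (w i - z i)⁻¹ * (X i - C (w i)))
      = (C ((w i - z i)⁻¹ * (w i - z i)) : MvPolynomial σ ℂ) := by
    rw [C_mul, C_sub]; ring
  rw [this, inv_mul_cancel₀ hne, C_1]

/-- Hadamard's lemma. -/
theorem exists_hadamard {z : σ → ℂ} {f : (σ → ℂ) → ℂ} (hf : AnalyticAt ℂ f z) :
    ∃ g : σ → (σ → ℂ) → ℂ, (∀ i, AnalyticAt ℂ (g i) z) ∧
      ∀ᶠ x in 𝓝 z, f x = f z + ∑ i, (x i - z i) * g i x := by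
  classical
  obtain ⟨p, r, hp⟩ := hf
  have hpos : 0 < p.shift.radius := by
    rw [p.radius_shift]; exact hp.r_pos.trans_le hp.r_le
  have hG : HasFPowerSeriesOnBall (fun x => p.shift.sum (x - z)) p.shift z p.shift.radius := by
    simpa using (p.shift.hasFPowerSeriesOnBall hpos).comp_sub z
  refine ⟨fun i x => p.shift.sum (x - z) (Pi.single i 1), fun i => ?_, ?_⟩
  · exact ((ContinuousLinearMap.apply ℂ ℂ (Pi.single i (1 : ℂ) : σ → ℂ)).analyticAt _).comp
      hG.analyticAt
  · have h2 := hG.unshift (z := f z)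
    have h3 : p.shift.unshift (f z) = p := by
      funext n
      cases n with
      | zero =>
        ext v
        have := hp.coeff_zero v
        simp [FormalMultilinearSeries.unshift, this]
      | succ n =>
        exact (continuousMultilinearCurryRightEquiv' ℂ n (σ → ℂ) ℂ).symm_apply_apply (p (n + 1))
    rw [h3] at h2
    have hb : Metric.eball z (min r p.shift.radius) ∈ 𝓝 z :=
      Metric.eball_mem_nhds z (lt_min hp.r_pos hpos)
    filter_upwards [hb] with x hx
    have h4 := (hp.mono (lt_min hp.r_pos hpos) (min_le_left _ _)).unique
      (h2.mono (lt_min hp.r_pos hpos) (min_le_right _ _)) hx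
    have hv : x - z = ∑ i, (x i - z i) • (Pi.single i (1 : ℂ) : σ → ℂ) := by
      ext j
      simp [Finset.sum_apply, Pi.single_apply]
    have h5 : p.shift.sum (x - z) (x - z) =
        ∑ i, (x i - z i) * p.shift.sum (x - z) (Pi.single i 1) := by
      conv_lhs => rw [hv, map_sum]
      rw [← hv]
      simp
    rw [h4, h5]

theorem germMax_eq_map (z : σ → ℂ) : germMax z = (pointIdeal z).map (polyGerm z) := by
  classical
  apply le_antisymm
  · intro g hg
    obtain ⟨f, hf, rfl⟩ := exists_toGerm g
    obtain ⟨G, hG, hfG⟩ := exists_hadamard hf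
    have h0 : f z = 0 := hg
    have : toGerm z f hf = ∑ i, polyGerm z (X i - C (z i)) * toGerm z (G i) (hG i) := by
      apply Subtype.ext
      rw [AddSubmonoidClass.coe_finsetSum]
      change (f : Filter.Germ (𝓝 z) ℂ) = ∑ i, ((fun x => (eval x (X i - C (z i) : MvPolynomial σ ℂ)) * G i x :
        (σ → ℂ) → ℂ) : Filter.Germ (𝓝 z) ℂ)
      have h6 := map_sum (Filter.Germ.coeRingHom (R := ℂ) (𝓝 z))
        (fun i x => (eval x (X i - C (z i) : MvPolynomial σ ℂ)) * G i x) Finset.univ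
      refine Eq.trans ?_ h6
      refine Filter.Germ.coe_eq.2 ?_
      filter_upwards [hfG] with x hx
      simp [hx, h0]
    rw [this]
    exact Ideal.sum_mem _ fun i _ => Ideal.mul_mem_right _ _
      (Ideal.mem_map_of_mem _ (X_sub_C_mem_pointIdeal z i))
  · refine Ideal.map_le_iff_le_comap.2 fun p hp => ?_
    rw [Ideal.mem_comap, germMax, RingHom.mem_ker, germValue_polyGerm]
    exact eval_eq_zero_of_mem_pointIdeal hp

theorem germMax_pow_eq_map (z : σ → ℂ) (k : ℕ) :
    germMax z ^ k = (pointIdeal z ^ k).map (polyGerm z) := by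
  rw [germMax_eq_map, Ideal.map_pow]

/-- Every germ is a polynomial up to an element of a given power of the maximal ideal. -/
theorem exists_poly_sub_mem (z : σ → ℂ) (k : ℕ) (g : analyticGermsAt z) :
    ∃ p : MvPolynomial σ ℂ, g - polyGerm z p ∈ germMax z ^ k := by
  induction k with
  | zero => exact ⟨0, by simp⟩
  | succ k ih =>
    have key : ∀ h ∈ germMax z ^ k, ∃ p ∈ pointIdeal z ^ k,
        h - polyGerm z p ∈ germMax z ^ (k + 1) := by
      intro h hh
      rw [germMax_pow_eq_map] at hh
      refine Submodule.span_induction ?_ ?_ ?_ ?_ hh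
      · rintro _ ⟨p, hp, rfl⟩
        exact ⟨p, hp, by simp⟩
      · exact ⟨0, zero_mem _, by simp⟩
      · rintro x y _ _ ⟨p, hp, hp'⟩ ⟨q, hq, hq'⟩
        refine ⟨p + q, add_mem hp hq, ?_⟩
        have := add_mem hp' hq'
        rw [map_add]
        convert this using 1
        ring
      · rintro a x _ ⟨p, hp, hp'⟩
        refine ⟨C (germValue z a) * p, Ideal.mul_mem_left _ _ hp, ?_⟩
        have h1 : a - algebraMap ℂ _ (germValue z a) ∈ germMax z := by
          rw [germMax, RingHom.mem_ker, map_sub, germValue_algebraMap, sub_self]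
        have h2 : polyGerm z p ∈ germMax z ^ k := by
          rw [germMax_pow_eq_map]; exact Ideal.mem_map_of_mem _ hp
        have h3 := Ideal.mul_mem_mul h1 h2
        rw [← pow_succ'] at h3
        have := add_mem (Ideal.mul_mem_left _ a hp') h3
        rw [map_mul, polyGerm_C, smul_eq_mul]
        convert this using 1
        ring
    obtain ⟨p, hp⟩ := ih
    obtain ⟨q, -, hq⟩ := key _ hp
    exact ⟨p + q, by rw [map_add, ← sub_sub]; exact hq⟩

end PolyGerms

section Order

theorem Polynomial.X_pow_dvd_of_isBigO {q : Polynomial ℂ} {k : ℕ}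
    (h : (fun t => q.eval t) =O[𝓝 0] fun t => ‖t‖ ^ k) : Polynomial.X ^ k ∣ q := by
  induction k with
  | zero => simp
  | succ k ih =>
    obtain ⟨r, rfl⟩ := ih (h.trans (Asymptotics.IsBigO.of_bound 1 (by
      filter_upwards [Metric.ball_mem_nhds (0 : ℂ) one_pos] with t ht
      rw [mem_ball_zero_iff] at ht
      simp only [norm_pow, norm_norm, one_mul]
      exact pow_le_pow_of_le_one (norm_nonneg _) ht.le (Nat.le_succ k))))
    have hr : Tendsto (fun t => r.eval t) (𝓝[≠] 0) (𝓝 0) := by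
      obtain ⟨C, hC⟩ := h.bound
      have h1 : ∀ᶠ t in 𝓝[≠] (0 : ℂ), ‖r.eval t‖ ≤ C * ‖t‖ := by
        filter_upwards [hC.filter_mono nhdsWithin_le_nhds, self_mem_nhdsWithin] with t ht ht0
        have hpos : 0 < ‖t‖ ^ k := pow_pos (norm_pos_iff.2 ht0) k
        simp only [Polynomial.eval_mul, Polynomial.eval_pow, Polynomial.eval_X, norm_mul,
          norm_pow, norm_norm] at ht
        refine le_of_mul_le_mul_left (ht.trans_eq ?_) hpos
        ring
      refine squeeze_zero_norm' h1 ?_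
      have : Tendsto (fun t : ℂ => C * ‖t‖) (𝓝 0) (𝓝 (C * ‖(0 : ℂ)‖)) :=
        (continuous_const.mul continuous_norm).tendsto 0
      rw [norm_zero, mul_zero] at this
      exact this.mono_left nhdsWithin_le_nhds
    have hr0 : r.eval 0 = 0 :=
      tendsto_nhds_unique ((r.continuous.tendsto 0).mono_left nhdsWithin_le_nhds) hr
    have : Polynomial.X ∣ r := by
      rw [Polynomial.X_dvd_iff, Polynomial.coeff_zero_eq_eval_zero, hr0]
    rw [pow_succ]
    exact mul_dvd_mul_left _ this

variable {σ : Type*} [Fintype σ]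

theorem MvPolynomial.IsHomogeneous.eval_smul {p : MvPolynomial σ ℂ} {n : ℕ}
    (hp : p.IsHomogeneous n) (t : ℂ) (v : σ → ℂ) : eval (t • v) p = t ^ n * eval v p := by
  rw [eval_eq', eval_eq', Finset.mul_sum]
  refine Finset.sum_congr rfl fun d hd => ?_
  have h := hp (mem_support_iff.1 hd)
  rw [Finsupp.weight_apply, Finsupp.sum_fintype _ _ (by simp)] at h
  simp only [Pi.one_apply, smul_eq_mul, mul_one] at h
  simp only [Pi.smul_apply, smul_eq_mul, mul_pow, Finset.prod_mul_distrib,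
    Finset.prod_pow_eq_pow_sum, h]
  ring

theorem mem_pow_idealOfVars_of_isBigO {q : MvPolynomial σ ℂ} {k : ℕ}
    (h : (fun x => eval x q) =O[𝓝 0] fun x => ‖x‖ ^ k) : q ∈ idealOfVars σ ℂ ^ k := by
  rw [mem_pow_idealOfVars_iff']
  intro d hd
  have key : homogeneousComponent d.degree q = 0 := by
    refine MvPolynomial.funext fun v => ?_
    let Q : Polynomial ℂ := ∑ n ∈ Finset.range (q.totalDegree + 1),
      Polynomial.C (eval v (homogeneousComponent n q)) * Polynomial.X ^ n
    have hQ : ∀ t, Q.eval t = eval (t • v) q := by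
      intro t
      rw [show eval (t • v) q = ∑ n ∈ Finset.range (q.totalDegree + 1),
        eval (t • v) (homogeneousComponent n q) by rw [← map_sum, sum_homogeneousComponent]]
      rw [Polynomial.eval_finsetSum]
      refine Finset.sum_congr rfl fun n _ => ?_
      rw [(homogeneousComponent_isHomogeneous n q).eval_smul]
      rw [Polynomial.eval_mul, Polynomial.eval_C, Polynomial.eval_pow, Polynomial.eval_X, mul_comm]
    have hO : (fun t => Q.eval t) =O[𝓝 0] fun t => ‖t‖ ^ k := by
      have ht : Tendsto (fun t : ℂ => t • v) (𝓝 0) (𝓝 0) := by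
        have : Continuous fun t : ℂ => t • v := by fun_prop
        simpa using this.tendsto 0
      simp only [hQ]
      refine (h.comp_tendsto ht).trans (Asymptotics.IsBigO.of_bound (‖v‖ ^ k) ?_)
      refine Eventually.of_forall fun t => ?_
      simp [norm_smul, mul_pow, mul_comm]
    have := Polynomial.X_pow_dvd_iff.1 (Polynomial.X_pow_dvd_of_isBigO hO) _ hd
    rw [map_zero]
    by_cases hdeg : d.degree < q.totalDegree + 1
    · rw [← this]
      rw [Polynomial.finsetSum_coeff, Finset.sum_eq_single_of_mem _ (Finset.mem_range.2 hdeg)]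
      · simp
      · intro n _ hn
        rw [Polynomial.coeff_C_mul_X_pow, if_neg hn.symm]
    · rw [homogeneousComponent_eq_zero _ _ (by omega), map_zero]
  have := congrArg (coeff d) key
  rwa [coeff_homogeneousComponent, if_pos rfl, coeff_zero] at this

theorem mem_pointIdeal_pow_of_isBigO {z : σ → ℂ} {p : MvPolynomial σ ℂ} {k : ℕ}
    (h : (fun x => eval x p) =O[𝓝 z] fun x => ‖x - z‖ ^ k) : p ∈ pointIdeal z ^ k := by
  let τ : MvPolynomial σ ℂ →ₐ[ℂ] MvPolynomial σ ℂ := aeval fun i => X i + C (z i)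
  let τ' : MvPolynomial σ ℂ →ₐ[ℂ] MvPolynomial σ ℂ := aeval fun i => X i - C (z i)
  have hττ : τ' (τ p) = p := by
    have : τ'.comp τ = AlgHom.id ℂ _ := by
      ext i
      simp [τ, τ']
    exact DFunLike.congr_fun this p
  have heval : ∀ x, eval x (τ p) = eval (x + z) p := by
    intro x
    have : (aeval x : MvPolynomial σ ℂ →ₐ[ℂ] ℂ).comp τ = aeval (x + z) := by
      ext i
      simp [τ]
    simpa [aeval_eq_eval] using DFunLike.congr_fun this p
  have hq : τ p ∈ idealOfVars σ ℂ ^ k := by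
    apply mem_pow_idealOfVars_of_isBigO
    simp only [heval]
    have ht : Tendsto (fun x : σ → ℂ => x + z) (𝓝 0) (𝓝 z) := by
      have : Continuous fun x : σ → ℂ => x + z := by fun_prop
      simpa using this.tendsto 0
    simpa [Function.comp_def] using h.comp_tendsto ht
  have := Ideal.mem_map_of_mem τ' hq
  rw [hττ, Ideal.map_pow] at this
  refine Ideal.pow_right_mono ?_ k this
  refine Ideal.map_le_iff_le_comap.2 (Ideal.span_le.2 ?_)
  rintro _ ⟨i, rfl⟩
  simpa [τ'] using X_sub_C_mem_pointIdeal z i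

theorem isBigO_of_mem_germMax_pow {z : σ → ℂ} {k : ℕ} {f : (σ → ℂ) → ℂ} {hf : AnalyticAt ℂ f z}
    (h : toGerm z f hf ∈ germMax z ^ k) : f =O[𝓝 z] fun x => ‖x - z‖ ^ k := by
  have key : ∀ g ∈ germMax z ^ k, ∃ (F : (σ → ℂ) → ℂ) (hF : AnalyticAt ℂ F z),
      toGerm z F hF = g ∧ F =O[𝓝 z] fun x => ‖x - z‖ ^ k := by
    clear h
    induction k with
    | zero =>
      intro g _
      obtain ⟨F, hF, rfl⟩ := exists_toGerm g
      exact ⟨F, hF, rfl, by simpa using hF.continuousAt.isBigO_one ℝ⟩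
    | succ k ih =>
      intro g hg
      rw [pow_succ] at hg
      refine Submodule.mul_induction_on hg ?_ ?_
      · intro a ha b hb
        obtain ⟨F, hF, rfl, hFO⟩ := ih a ha
        obtain ⟨G, hG, rfl⟩ := exists_toGerm b
        refine ⟨F * G, hF.mul hG, (toGerm_mul hF hG).symm, ?_⟩
        have hG0 : G z = 0 := hb
        have hGO := hG.differentiableAt.isBigO_sub
        simp only [hG0, sub_zero] at hGO
        simp only [pow_succ]
        exact hFO.mul hGO.norm_right
      · rintro _ _ ⟨F, hF, rfl, hFO⟩ ⟨G, hG, rfl, hGO⟩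
        exact ⟨F + G, hF.add hG, (toGerm_add hF hG).symm, hFO.add hGO⟩
  obtain ⟨F, hF, hFf, hO⟩ := key _ h
  exact hO.congr' (toGerm_eq_iff.1 hFf) EventuallyEq.rfl

theorem mem_pointIdeal_pow_of_polyGerm_mem {z : σ → ℂ} {p : MvPolynomial σ ℂ} {k : ℕ}
    (h : polyGerm z p ∈ germMax z ^ k) : p ∈ pointIdeal z ^ k :=
  mem_pointIdeal_pow_of_isBigO (isBigO_of_mem_germMax_pow (hf := analyticAt_eval p z) h)

theorem mem_germMax_pow_iff {z : σ → ℂ} {k : ℕ} {f : (σ → ℂ) → ℂ} {hf : AnalyticAt ℂ f z} :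
    toGerm z f hf ∈ germMax z ^ k ↔ f =O[𝓝 z] fun x => ‖x - z‖ ^ k := by
  refine ⟨isBigO_of_mem_germMax_pow, fun h => ?_⟩
  obtain ⟨p, hp⟩ := exists_poly_sub_mem z k (toGerm z f hf)
  have h1 : toGerm z f hf - polyGerm z p
    = toGerm z (f - fun x => eval x p) (hf.sub (analyticAt_eval p z)) := rfl
  have h2 : (fun x => eval x p) =O[𝓝 z] fun x => ‖x - z‖ ^ k := by
    have := h.sub (isBigO_of_mem_germMax_pow (h1 ▸ hp))
    simpa using this
  have h3 : polyGerm z p ∈ germMax z ^ k := by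
    rw [germMax_pow_eq_map]
    exact Ideal.mem_map_of_mem _ (mem_pointIdeal_pow_of_isBigO h2)
  simpa using add_mem hp h3

/-- Finite determinacy of the ideal generated by a system with finite multiplicity. -/
theorem solIdeal_eq_of_isBigO {ι : Type*} [Finite ι] {z : σ → ℂ} {F G : ι → (σ → ℂ) → ℂ} {d : ℕ}
    (hF : ∀ i, AnalyticAt ℂ (F i) z) (hG : ∀ i, AnalyticAt ℂ (G i) z)
    (hd : germMax z ^ d ≤ solIdeal z F)
    (hFG : ∀ i, (F i - G i) =O[𝓝 z] fun x => ‖x - z‖ ^ (d + 1)) :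
    solIdeal z G = solIdeal z F := by
  rw [solIdeal, solIdeal, solIdeal_eq hF, solIdeal_eq hG]
  rw [solIdeal, solIdeal_eq hF] at hd
  refine Ideal.span_range_eq_of_sub_mem (germMax_le_jacobson z) hd fun i => ?_
  rw [toGerm_sub, mem_germMax_pow_iff]
  exact hFG i

/-- A Łojasiewicz inequality for systems with finite multiplicity. -/
theorem exists_norm_ge_of_pow_le {ι : Type*} [Fintype ι] {z : σ → ℂ} {f : (σ → ℂ) → ι → ℂ}
    (hf : ∀ i, AnalyticAt ℂ (fun x => f x i) z) {k : ℕ}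
    (hk : germMax z ^ k ≤ solIdeal z fun i x => f x i) :
    ∃ a > 0, ∀ᶠ x in 𝓝 z, a * ‖x - z‖ ^ k ≤ ‖f x‖ := by
  rw [solIdeal, solIdeal_eq hf] at hk
  have key : ∀ g ∈ Ideal.span (Set.range fun i => toGerm z (fun x => f x i) (hf i)),
      ∃ (F : (σ → ℂ) → ℂ) (hF : AnalyticAt ℂ F z), toGerm z F hF = g ∧ F =O[𝓝 z] f := by
    intro g hg
    refine Submodule.span_induction ?_ ?_ ?_ ?_ hg
    · rintro _ ⟨i, rfl⟩
      exact ⟨_, hf i, rfl, Asymptotics.isBigO_of_le _ fun x => norm_le_pi_norm (f x) i⟩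
    · exact ⟨fun _ => 0, analyticAt_const, rfl, Asymptotics.isBigO_zero _ _⟩
    · rintro _ _ _ _ ⟨F, hF, rfl, hFO⟩ ⟨G, hG, rfl, hGO⟩
      exact ⟨F + G, hF.add hG, (toGerm_add hF hG).symm, hFO.add hGO⟩
    · rintro a _ _ ⟨F, hF, rfl, hFO⟩
      obtain ⟨G, hG, rfl⟩ := exists_toGerm a
      refine ⟨G * F, hG.mul hF, (toGerm_mul hG hF).symm, ?_⟩
      have := (hG.continuousAt.isBigO_one ℝ).mul hFO.norm_right
      simp only [one_mul] at this
      exact this.of_norm_right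
  have h1 : ∀ j, (fun x => (x j - z j) ^ k) =O[𝓝 z] f := by
    intro j
    have hm : polyGerm z ((X j - C (z j)) ^ k) ∈ germMax z ^ k := by
      rw [germMax_pow_eq_map]
      exact Ideal.mem_map_of_mem _ (Ideal.pow_mem_pow (X_sub_C_mem_pointIdeal z j) k)
    obtain ⟨F, hF, hFg, hFO⟩ := key _ (hk hm)
    rw [polyGerm_apply, toGerm_eq_iff] at hFg
    refine hFO.congr' (hFg.trans ?_) EventuallyEq.rfl
    exact Eventually.of_forall fun x => by simp
  have h2 : (fun x => ‖x - z‖ ^ k) =O[𝓝 z] f := by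
    rcases Nat.eq_zero_or_pos k with rfl | hk0
    · obtain ⟨F, hF, hFg, hFO⟩ := key 1 (hk (by simp))
      change _ = toGerm z (fun _ => 1) analyticAt_const at hFg
      refine (hFO.congr' (toGerm_eq_iff.1 hFg) EventuallyEq.rfl).norm_left.congr_left fun x => ?_
      simp
    · refine (Asymptotics.IsBigO.of_bound 1 (Eventually.of_forall fun x => ?_)).trans
        (Asymptotics.IsBigO.sum fun j (_ : j ∈ Finset.univ) => (h1 j).norm_left)
      rcases isEmpty_or_nonempty σ with hσ | hσ
      · simp [Subsingleton.elim x z, hk0.ne']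
      · obtain ⟨j, hj⟩ := Finite.exists_max fun j => ‖(x - z) j‖
        have hle : ‖x - z‖ ≤ ‖(x - z) j‖ := (pi_norm_le_iff_of_nonneg (norm_nonneg _)).2 hj
        have hs := Finset.single_le_sum (f := fun j => ‖(x j - z j) ^ k‖)
          (fun i _ => norm_nonneg _) (Finset.mem_univ j)
        rw [norm_pow, norm_norm, one_mul]
        refine (pow_le_pow_left₀ (norm_nonneg _) hle k).trans ?_
        rw [← norm_pow]
        rw [Finset.sum_apply]
        exact hs.trans (le_abs_self _)
  obtain ⟨C, hC, hb⟩ := h2.exists_pos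
  refine ⟨C⁻¹, inv_pos.2 hC, ?_⟩
  filter_upwards [hb.bound] with x hx
  rw [inv_mul_le_iff₀ hC]
  simpa using hx

end Order

section Trace

theorem LinearMap.trace_eq_sum_proj_single {K ι : Type*} [Field K] [Fintype ι] [DecidableEq ι]
    {V : ι → Type*} [∀ i, AddCommGroup (V i)] [∀ i, Module K (V i)]
    [∀ i, Module.Finite K (V i)] (T : (∀ i, V i) →ₗ[K] ∀ i, V i) :
    LinearMap.trace K _ T =
      ∑ i, LinearMap.trace K (V i) (LinearMap.proj i ∘ₗ T ∘ₗ LinearMap.single K V i) := by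
  have h : T = ∑ i, (T ∘ₗ LinearMap.single K V i) ∘ₗ LinearMap.proj i := by
    refine LinearMap.ext fun v => ?_
    conv_lhs => rw [← Finset.univ_sum_single v, map_sum]
    simp [LinearMap.sum_apply]
  conv_lhs => rw [h, map_sum]
  exact Finset.sum_congr rfl fun i _ => LinearMap.trace_comp_comm' _ _

theorem Algebra.trace_pi_apply {K ι : Type*} [Field K] [Fintype ι] {B : ι → Type*}
    [∀ i, CommRing (B i)] [∀ i, Algebra K (B i)] [∀ i, Module.Finite K (B i)] (b : ∀ i, B i) :
    Algebra.trace K (∀ i, B i) b = ∑ i, Algebra.trace K (B i) (b i) := by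
  classical
  rw [Algebra.trace_apply, LinearMap.trace_eq_sum_proj_single]
  refine Finset.sum_congr rfl fun i _ => ?_
  rw [Algebra.trace_apply]
  congr 1
  ext v
  simp

theorem Algebra.trace_eq_finrank_mul_of_isNilpotent {K A : Type*} [Field K] [CommRing A]
    [Algebra K A] [Module.Finite K A] {a : A} {c : K} (h : IsNilpotent (a - algebraMap K A c)) :
    Algebra.trace K A a = Module.finrank K A * c := by
  have h0 : Algebra.trace K A (a - algebraMap K A c) = 0 :=
    (LinearMap.isNilpotent_trace_of_isNilpotent (h.map (Algebra.lmul K A))).eq_zero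
  rw [map_sub, Algebra.trace_algebraMap, nsmul_eq_mul] at h0
  exact sub_eq_zero.1 h0

end Trace

theorem Ideal.prod_sup_le {R ι : Type*} [CommRing R] (I : Ideal R) (s : Finset ι)
    (J : ι → Ideal R) : ∏ i ∈ s, (I ⊔ J i) ≤ I ⊔ ∏ i ∈ s, J i := by
  classical
  induction s using Finset.induction_on with
  | empty => simp
  | insert a s ha ih =>
    rw [Finset.prod_insert ha, Finset.prod_insert ha]
    refine (Ideal.mul_mono_right ih).trans ?_
    rw [Ideal.sup_mul, Ideal.mul_sup (J a)]
    refine sup_le (Ideal.mul_le_left.trans le_sup_left) (sup_le ?_ le_sup_right)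
    exact Ideal.mul_le_right.trans le_sup_left

section LocalToGlobal

variable {σ ι : Type*} [Fintype σ] (P : ι → MvPolynomial σ ℂ)

/-- The common zeros of a family of polynomials. -/
def zeros : Set (σ → ℂ) := {z | ∀ i, eval z (P i) = 0}

/-- The ideal of germs at `z` generated by a family of polynomials. -/
noncomputable abbrev polyIdeal (z : σ → ℂ) : Ideal (analyticGermsAt z) :=
  solIdeal z fun i x => eval x (P i)

theorem polyIdeal_eq_map (z : σ → ℂ) :
    polyIdeal P z = (Ideal.span (Set.range P)).map (polyGerm z) := by
  rw [polyIdeal, solIdeal, solIdeal_eq fun i => analyticAt_eval (P i) z, Ideal.map_span,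
    ← Set.range_comp]
  rfl

/-- The germ of a polynomial, modulo the ideal generated by a family of polynomials. -/
noncomputable def polyGermQuot (z : σ → ℂ) :
    MvPolynomial σ ℂ →ₐ[ℂ] analyticGermsAt z ⧸ polyIdeal P z :=
  (Ideal.Quotient.mkₐ ℂ (polyIdeal P z)).comp
    { polyGerm z with commutes' := fun c => polyGerm_C z c }

theorem polyGermQuot_eq_zero_iff {z : σ → ℂ} {p : MvPolynomial σ ℂ} :
    polyGermQuot P z p = 0 ↔ polyGerm z p ∈ polyIdeal P z :=
  Ideal.Quotient.eq_zero_iff_mem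

variable {P}

theorem polyGermQuot_surjective {z : σ → ℂ} {k : ℕ} (h : germMax z ^ k ≤ polyIdeal P z) :
    Function.Surjective (polyGermQuot P z) := by
  intro g
  obtain ⟨g, rfl⟩ := Ideal.Quotient.mk_surjective g
  obtain ⟨p, hp⟩ := exists_poly_sub_mem z k g
  exact ⟨p, ((Ideal.Quotient.mk_eq_mk_iff_sub_mem _ _).2 (h hp)).symm⟩

theorem mem_sup_pow_of_polyGerm_mem {z : σ → ℂ} {p : MvPolynomial σ ℂ}
    (h : polyGerm z p ∈ polyIdeal P z) (k : ℕ) :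
    p ∈ Ideal.span (Set.range P) ⊔ pointIdeal z ^ k := by
  have key : ∀ g ∈ (Ideal.span (Set.range P)).map (polyGerm z),
      ∃ q ∈ Ideal.span (Set.range P), g - polyGerm z q ∈ germMax z ^ k := by
    intro g hg
    refine Submodule.span_induction ?_ ?_ ?_ ?_ hg
    · rintro _ ⟨q, hq, rfl⟩
      exact ⟨q, hq, by simp⟩
    · exact ⟨0, zero_mem _, by simp⟩
    · rintro x y _ _ ⟨q, hq, hx⟩ ⟨r, hr, hy⟩
      refine ⟨q + r, add_mem hq hr, ?_⟩
      rw [map_add, add_sub_add_comm]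
      exact add_mem hx hy
    · rintro a x _ ⟨q, hq, hx⟩
      obtain ⟨r, hr⟩ := exists_poly_sub_mem z k a
      refine ⟨r * q, Ideal.mul_mem_left _ _ hq, ?_⟩
      have := add_mem (Ideal.mul_mem_left _ a hx) (Ideal.mul_mem_right (polyGerm z q) _ hr)
      rw [map_mul, smul_eq_mul]
      convert this using 1
      ring
  rw [polyIdeal_eq_map] at h
  obtain ⟨q, hq, hpq⟩ := key _ h
  rw [← map_sub] at hpq
  simpa using add_mem (Ideal.mem_sup_left hq : q ∈ _ ⊔ pointIdeal z ^ k)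
    (Ideal.mem_sup_right (mem_pointIdeal_pow_of_polyGerm_mem hpq))

theorem zeros_finite (hfin : Module.Finite ℂ (MvPolynomial σ ℂ ⧸ Ideal.span (Set.range P))) :
    (zeros P).Finite := by
  set I := Ideal.span (Set.range P) with hI
  let m : σ → Polynomial ℂ := fun i => minpoly ℂ (Ideal.Quotient.mkₐ ℂ I (X i))
  have hm : ∀ i, m i ≠ 0 := fun i => minpoly.ne_zero (Algebra.IsIntegral.isIntegral _)
  refine (Set.Finite.pi fun i => (m i).rootSet_finite ℂ).subset fun z hz i _ => ?_
  rw [Polynomial.mem_rootSet_of_ne (hm i)]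
  let ev : (MvPolynomial σ ℂ ⧸ I) →ₐ[ℂ] ℂ := Ideal.Quotient.liftₐ I (aeval z) (by
    intro a ha
    have : I ≤ RingHom.ker (aeval z : MvPolynomial σ ℂ →ₐ[ℂ] ℂ) := by
      refine Ideal.span_le.2 ?_
      rintro _ ⟨i, rfl⟩
      simpa [aeval_eq_eval] using hz i
    exact this ha)
  have h := congrArg ev (minpoly.aeval ℂ (Ideal.Quotient.mkₐ ℂ I (X i)))
  rw [map_zero, ← Polynomial.aeval_algHom_apply] at h
  have : ev (Ideal.Quotient.mkₐ ℂ I (X i)) = z i :=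
    aeval_X z i
  rwa [this] at h

theorem exists_prod_pointIdeal_pow_le (hZ : (zeros P).Finite) :
    ∃ k, (∏ z ∈ hZ.toFinset, pointIdeal z) ^ k ≤ Ideal.span (Set.range P) := by
  obtain ⟨k, hk⟩ := Ideal.exists_radical_pow_le_of_fg (Ideal.span (Set.range P))
    (IsNoetherian.noetherian _)
  refine ⟨k, le_trans (Ideal.pow_right_mono ?_ k) hk⟩
  rw [← vanishingIdeal_zeroLocus_eq_radical (K := ℂ)]
  intro p hp z hz
  have hz' : z ∈ zeros P := fun i => by
    simpa [aeval_eq_eval] using hz (P i) (Ideal.subset_span ⟨i, rfl⟩)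
  rw [aeval_eq_eval]
  exact eval_eq_zero_of_mem_pointIdeal
    (Ideal.le_of_dvd (Finset.dvd_prod_of_mem _ (hZ.mem_toFinset.2 hz')) hp)

theorem germMax_pow_le_polyIdeal (hZ : (zeros P).Finite) {k : ℕ}
    (hk : (∏ z ∈ hZ.toFinset, pointIdeal z) ^ k ≤ Ideal.span (Set.range P)) {z : σ → ℂ}
    (hz : z ∈ zeros P) : germMax z ^ k ≤ polyIdeal P z := by
  have h := Ideal.map_mono (f := polyGerm z) hk
  rw [← polyIdeal_eq_map, Ideal.map_pow] at h
  convert h using 2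
  change _ = Ideal.mapHom (polyGerm z) _
  rw [germMax_eq_map, map_prod]
  change Ideal.mapHom (polyGerm z) _ = _
  refine (Finset.prod_eq_single_of_mem (f := fun w =>
    Ideal.mapHom (polyGerm z) (pointIdeal w)) z (hZ.mem_toFinset.2 hz) fun w _ hw => ?_).symm
  obtain ⟨i, hi⟩ := Function.ne_iff.1 hw
  rw [Ideal.one_eq_top, Ideal.mapHom_apply]
  refine Ideal.eq_top_of_isUnit_mem _
    (Ideal.mem_map_of_mem (polyGerm z) (X_sub_C_mem_pointIdeal w i)) (isUnit_germ ?_)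
  rw [germValue_polyGerm]
  simpa [sub_eq_zero] using hi.symm

theorem finite_quotient_polyIdeal
    (hfin : Module.Finite ℂ (MvPolynomial σ ℂ ⧸ Ideal.span (Set.range P))) {z : σ → ℂ}
    (hz : z ∈ zeros P) : Module.Finite ℂ (analyticGermsAt z ⧸ polyIdeal P z) := by
  obtain ⟨k, hk⟩ := exists_prod_pointIdeal_pow_le (zeros_finite hfin)
  have hI : ∀ a ∈ Ideal.span (Set.range P), polyGermQuot P z a = 0 := fun a ha => by
    rw [polyGermQuot_eq_zero_iff, polyIdeal_eq_map]
    exact Ideal.mem_map_of_mem _ ha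
  refine Module.Finite.of_surjective (Ideal.Quotient.liftₐ _ (polyGermQuot P z) hI).toLinearMap ?_
  exact Ideal.Quotient.lift_surjective_of_surjective _ hI
    (polyGermQuot_surjective (germMax_pow_le_polyIdeal _ hk hz))

/-- The trace of multiplication by a polynomial is the sum of its values at the common zeros,
weighted by multiplicities. -/
theorem trace_eq_sum (hfin : Module.Finite ℂ (MvPolynomial σ ℂ ⧸ Ideal.span (Set.range P)))
    (h : MvPolynomial σ ℂ) :
    Algebra.trace ℂ (MvPolynomial σ ℂ ⧸ Ideal.span (Set.range P)) (Ideal.Quotient.mk _ h) =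
      ∑ z ∈ (zeros_finite hfin).toFinset,
        (solMultiplicity z fun i x => eval x (P i) : ℂ) * eval z h := by
  classical
  have hZ := zeros_finite hfin
  obtain ⟨k, hk⟩ := exists_prod_pointIdeal_pow_le hZ
  have hmax : ∀ z ∈ zeros P, germMax z ^ k ≤ polyIdeal P z :=
    fun z hz => germMax_pow_le_polyIdeal hZ hk hz
  have : Fintype (zeros P) := hZ.fintype
  have : ∀ z : zeros P, Module.Finite ℂ (analyticGermsAt z.1 ⧸ polyIdeal P z.1) :=
    fun z => finite_quotient_polyIdeal hfin z.2
  let Φ : MvPolynomial σ ℂ →ₐ[ℂ] ∀ z : zeros P, analyticGermsAt z.1 ⧸ polyIdeal P z.1 :=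
    AlgHom.pi fun z : zeros P => polyGermQuot P z.1
  have hΦ : ∀ a, Φ a = 0 ↔ a ∈ Ideal.span (Set.range P) := by
    intro a
    constructor
    · intro ha
      have h1 : ∀ z ∈ hZ.toFinset, a ∈ Ideal.span (Set.range P) ⊔ pointIdeal z ^ k := by
        intro z hz
        refine mem_sup_pow_of_polyGerm_mem ?_ k
        rw [← polyGermQuot_eq_zero_iff]
        exact congrFun ha ⟨z, hZ.mem_toFinset.1 hz⟩
      have hk' : ∏ z ∈ hZ.toFinset, pointIdeal z ^ k ≤ Ideal.span (Set.range P) := by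
        rwa [Finset.prod_pow]
      have hco : ∀ z w : σ → ℂ, z ≠ w → IsCoprime (Ideal.span (Set.range P) ⊔ pointIdeal z ^ k)
          (Ideal.span (Set.range P) ⊔ pointIdeal w ^ k) := by
        intro z w hzw
        have h3 : IsCoprime (pointIdeal z ^ k) (pointIdeal w ^ k) :=
          IsCoprime.pow (isCoprime_pointIdeal hzw)
        rw [Ideal.isCoprime_iff_sup_eq] at h3 ⊢
        exact top_le_iff.1 (h3.ge.trans (sup_le_sup le_sup_right le_sup_right))
      have h2 : a ∈ ⨅ z ∈ hZ.toFinset, (Ideal.span (Set.range P) ⊔ pointIdeal z ^ k) := by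
        simpa only [Submodule.mem_iInf] using h1
      rw [← Ideal.prod_eq_iInf_of_pairwise_isCoprime fun z _ w _ hzw =>
        hco z w hzw] at h2
      exact (Ideal.prod_sup_le _ _ _).trans (sup_le le_rfl hk') h2
    · intro ha
      funext z
      change polyGermQuot P z.1 a = 0
      rw [polyGermQuot_eq_zero_iff, polyIdeal_eq_map]
      exact Ideal.mem_map_of_mem _ ha
  have hΦs : Function.Surjective Φ := by
    intro b
    choose g hg using fun z : zeros P => polyGermQuot_surjective (hmax z.1 z.2) (b z)
    obtain ⟨a, ha⟩ := Ideal.exists_forall_sub_mem_ideal 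
      (I := fun z : zeros P => pointIdeal z.1 ^ k) (fun z w hzw =>
        IsCoprime.pow (isCoprime_pointIdeal fun h => hzw (Subtype.ext h))) g
    refine ⟨a, funext fun z => ?_⟩
    rw [← hg z, ← sub_eq_zero]
    change polyGermQuot P z.1 a - _ = 0
    rw [← map_sub, polyGermQuot_eq_zero_iff]
    refine hmax z.1 z.2 ?_
    rw [germMax_pow_eq_map]
    exact Ideal.mem_map_of_mem _ (ha z)
  let e : (MvPolynomial σ ℂ ⧸ Ideal.span (Set.range P)) ≃ₐ[ℂ]
      ∀ z : zeros P, analyticGermsAt z.1 ⧸ polyIdeal P z.1 :=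
    AlgEquiv.ofBijective (Ideal.Quotient.liftₐ _ Φ fun a ha => (hΦ a).2 ha)
      ⟨(injective_iff_map_eq_zero _).2 fun a ha => by
        obtain ⟨a, rfl⟩ := Ideal.Quotient.mk_surjective a
        exact Ideal.Quotient.eq_zero_iff_mem.2 ((hΦ a).1 ha),
      Ideal.Quotient.lift_surjective_of_surjective _ _ hΦs⟩
  rw [← Algebra.trace_eq_of_algEquiv
    (C := ∀ z : zeros P, analyticGermsAt z.1 ⧸ polyIdeal P z.1) e, Algebra.trace_pi_apply]
  rw [Finset.sum_subtype _ (fun z => (zeros_finite hfin).mem_toFinset)]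
  refine Finset.sum_congr rfl fun z _ => ?_
  change Algebra.trace ℂ _ (polyGermQuot P z.1 h) = _
  refine Algebra.trace_eq_finrank_mul_of_isNilpotent ⟨k, ?_⟩
  have : algebraMap ℂ (analyticGermsAt z.1 ⧸ polyIdeal P z.1) (eval z.1 h)
      = polyGermQuot P z.1 (C (eval z.1 h)) := (AlgHom.commutes _ _).symm
  rw [this, ← map_sub, ← map_pow, polyGermQuot_eq_zero_iff]
  refine hmax z.1 z.2 ?_
  rw [germMax_pow_eq_map]
  exact Ideal.mem_map_of_mem _ (Ideal.pow_mem_pow (sub_C_eval_mem_pointIdeal z.1 h) k)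

end LocalToGlobal

section Pencil

variable {σ R : Type*} [CommRing R]

/-- The affine pencil joining two systems of polynomials. -/
noncomputable def pencil (P Q : σ → MvPolynomial σ R) (t : R) (i : σ) : MvPolynomial σ R :=
  P i + C t * (Q i - P i)

theorem IsPham.pencil {D : ℕ} {P Q : σ → MvPolynomial σ R} (hP : IsPham D P) (hQ : IsPham D Q)
    (t : R) : IsPham D (pencil P Q t) := by
  intro i
  have h := (degLT σ R (Finsupp.single i D).degree).add_mem (hP i)
    ((degLT σ R _).smul_mem t ((degLT σ R _).sub_mem (hQ i) (hP i)))
  rw [HasLead]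
  convert h using 1
  rw [_root_.pencil, smul_eq_C_mul]
  ring

variable [Fintype σ]

theorem IsPham.traceNF_congr {D : ℕ} {P Q : σ → MvPolynomial σ R} (hP : IsPham D P)
    (hQ : IsPham D Q) (h : MvPolynomial σ R) (e : P = Q) : hP.traceNF h = hQ.traceNF h := by
  subst e
  rfl

theorem IsPham.exists_traceNF_pencil {D : ℕ} {P Q : σ → MvPolynomial σ ℂ} (hP : IsPham D P)
    (hQ : IsPham D Q) (h : MvPolynomial σ ℂ) :
    ∃ q : Polynomial ℂ, ∀ t, (hP.pencil hQ t).traceNF h = q.eval t := by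
  refine ⟨((hP.map Polynomial.C).pencil (hQ.map Polynomial.C) Polynomial.X).traceNF
    (MvPolynomial.map Polynomial.C h), fun t => ?_⟩
  rw [← Polynomial.coe_evalRingHom, IsPham.map_traceNF]
  have hC : (Polynomial.evalRingHom t).comp Polynomial.C = RingHom.id ℂ := by
    ext; simp
  rw [MvPolynomial.map_map, hC, MvPolynomial.map_id]
  refine IsPham.traceNF_congr _ _ _ (funext fun i => ?_)
  simp [_root_.pencil, MvPolynomial.map_map, hC, MvPolynomial.map_id]

end Pencil

section Count

variable {σ : Type*} [Fintype σ]

/-- The multiplicity of a point as a common zero of a family of polynomials. -/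
noncomputable abbrev polyMult {ι : Type*} (P : ι → MvPolynomial σ ℂ) (z : σ → ℂ) : ℕ :=
  solMultiplicity z fun i x => eval x (P i)

/-- The number of common zeros in `U` of a family of polynomials, with multiplicities. -/
noncomputable def zeroCount {ι : Type*} (P : ι → MvPolynomial σ ℂ) (U : Set (σ → ℂ)) : ℕ :=
  ∑ᶠ z ∈ zeros P ∩ U, polyMult P z

variable {D : ℕ} {P : σ → MvPolynomial σ ℂ}

theorem IsPham.zeros_finite (hP : IsPham D P) (hD : 0 < D) : (zeros P).Finite :=
  _root_.zeros_finite (hP.finite_quotient hD)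

theorem IsPham.finite_quotient_polyIdeal (hP : IsPham D P) (hD : 0 < D) {z : σ → ℂ}
    (hz : z ∈ zeros P) : Module.Finite ℂ (analyticGermsAt z ⧸ polyIdeal P z) :=
  _root_.finite_quotient_polyIdeal (hP.finite_quotient hD) hz

theorem IsPham.traceNF_eq_sum (hP : IsPham D P) (hD : 0 < D) (h : MvPolynomial σ ℂ) :
    hP.traceNF h = ∑ z ∈ (hP.zeros_finite hD).toFinset, (polyMult P z : ℂ) * eval z h := by
  rw [← hP.trace_eq hD, trace_eq_sum (hP.finite_quotient hD)]

theorem IsPham.sum_polyMult (hP : IsPham D P) (hD : 0 < D) :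
    ∑ z ∈ (hP.zeros_finite hD).toFinset, polyMult P z = D ^ Fintype.card σ := by
  classical
  have h := hP.traceNF_eq_sum hD 1
  have hfin := hP.finite_quotient hD
  rw [← hP.trace_eq hD, map_one, ← map_one (algebraMap ℂ _), Algebra.trace_algebraMap,
    (hP.quotEquiv hD).finrank_eq, nsmul_one] at h
  simp only [map_one, mul_one, Module.finrank_fintype_fun_eq_card, Fintype.card_fun,
    Fintype.card_fin] at h
  exact_mod_cast h.symm

open Classical in
theorem IsPham.zeroCount_eq (hP : IsPham D P) (hD : 0 < D) (U : Set (σ → ℂ)) :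
    zeroCount P U = ∑ z ∈ (hP.zeros_finite hD).toFinset with z ∈ U, polyMult P z := by
  rw [zeroCount]
  refine finsum_mem_eq_finite_toFinset_sum _ ((hP.zeros_finite hD).inter_of_left U) |>.trans ?_
  refine Finset.sum_congr ?_ fun _ _ => rfl
  ext z
  simp

omit [Fintype σ] in
theorem exists_eval_eq (s : Set (σ → ℂ)) (hs : s.Finite) (c : (σ → ℂ) → ℂ) :
    ∃ h : MvPolynomial σ ℂ, ∀ z ∈ s, eval z h = c z := by
  have : Finite s := hs
  obtain ⟨h, hh⟩ := Ideal.exists_forall_sub_mem_ideal (I := fun z : s => pointIdeal z.1)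
    (fun z w hzw => isCoprime_pointIdeal fun h => hzw (Subtype.ext h)) fun z => C (c z.1)
  refine ⟨h, fun z hz => ?_⟩
  have := eval_eq_zero_of_mem_pointIdeal (hh ⟨z, hz⟩)
  simpa [sub_eq_zero] using this

theorem norm_eval_le_of_mem_degLT {d : ℕ} {p : MvPolynomial σ ℂ} (hp : p ∈ degLT σ ℂ (d + 1)) :
    ∃ c, 0 ≤ c ∧ ∀ z : σ → ℂ, 1 ≤ ‖z‖ → ‖eval z p‖ ≤ c * ‖z‖ ^ d := by
  refine ⟨∑ m ∈ p.support, ‖coeff m p‖, Finset.sum_nonneg fun _ _ => norm_nonneg _,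
    fun z hz => ?_⟩
  rw [eval_eq', Finset.sum_mul]
  refine (norm_sum_le _ _).trans (Finset.sum_le_sum fun m hm => ?_)
  rw [norm_mul]
  refine mul_le_mul_of_nonneg_left ?_ (norm_nonneg _)
  have hm' : m.degree ≤ d := by
    by_contra hc
    exact (mem_support_iff.1 hm) (hp m (by omega))
  calc ‖∏ i, z i ^ m i‖ ≤ ∏ i, ‖z‖ ^ m i := by
        rw [norm_prod]
        refine Finset.prod_le_prod (fun _ _ => norm_nonneg _) fun i _ => ?_
        rw [norm_pow]
        exact pow_le_pow_left₀ (norm_nonneg _) (norm_le_pi_norm z i) _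
    _ = ‖z‖ ^ m.degree := by
        rw [Finset.prod_pow_eq_pow_sum, Finsupp.degree_eq_sum]
    _ ≤ ‖z‖ ^ d := pow_le_pow_right₀ hz hm'

theorem exists_zeros_pencil_bound (hD : 0 < D) {Q : σ → MvPolynomial σ ℂ} (hP : IsPham D P)
    (hQ : IsPham D Q) : ∃ B : ℝ, ∀ t : ℂ, ‖t‖ ≤ 1 → ∀ z ∈ zeros (pencil P Q t), ‖z‖ ≤ B := by
  obtain ⟨d, rfl⟩ := Nat.exists_eq_succ_of_ne_zero hD.ne'
  have h1 : ∀ {S : σ → MvPolynomial σ ℂ}, IsPham (d + 1) S → ∀ i,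
      S i - X i ^ (d + 1) ∈ degLT σ ℂ (d + 1) := by
    intro S hS i
    have := hS i
    rwa [HasLead, Finsupp.degree_single, ← X_pow_eq_monomial] at this
  choose c hc0 hc using fun i => norm_eval_le_of_mem_degLT (h1 hP i)
  choose e he0 he using fun i => norm_eval_le_of_mem_degLT
    ((degLT σ ℂ (d + 1)).sub_mem (h1 hQ i) (h1 hP i))
  refine ⟨1 + ∑ i, (c i + e i), fun t ht z hz => ?_⟩
  have hnn : ∀ i, 0 ≤ c i + e i := fun i => add_nonneg (hc0 i) (he0 i)
  have hsum : 0 ≤ ∑ i, (c i + e i) := Finset.sum_nonneg fun i _ => hnn i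
  by_cases hz1 : 1 ≤ ‖z‖
  · rcases isEmpty_or_nonempty σ with hσ | hσ
    · rw [Subsingleton.elim z 0, norm_zero]
      positivity
    · obtain ⟨i, hi⟩ := Finite.exists_max fun j => ‖z j‖
      have hzi : ‖z‖ = ‖z i‖ := le_antisymm ((pi_norm_le_iff_of_nonneg (norm_nonneg _)).2 hi)
        (norm_le_pi_norm z i)
      have h0 := hz i
      have h2 : z i ^ (d + 1) = -(eval z (P i - X i ^ (d + 1)) +
          t * eval z (Q i - X i ^ (d + 1) - (P i - X i ^ (d + 1)))) := by
        simp only [pencil, map_add, map_mul, map_sub, eval_C, map_pow, eval_X] at h0 ⊢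
        linear_combination h0
      have h3 : ‖z‖ ^ (d + 1) ≤ (c i + e i) * ‖z‖ ^ d := by
        rw [hzi, ← norm_pow, h2, norm_neg, ← hzi, add_mul]
        refine (norm_add_le _ _).trans (add_le_add (hc i z hz1) ?_)
        rw [norm_mul]
        calc ‖t‖ * _ ≤ 1 * (e i * ‖z‖ ^ d) :=
              mul_le_mul ht (he i z hz1) (norm_nonneg _) zero_le_one
          _ = _ := one_mul _
      rw [pow_succ'] at h3
      have h4 := le_of_mul_le_mul_right h3 (by positivity)
      have h5 := Finset.single_le_sum (f := fun i => c i + e i) (fun i _ => hnn i)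
        (Finset.mem_univ i)
      linarith
  · linarith

end Count

section PathInvariance

variable {σ : Type*} [Fintype σ] {D : ℕ} {P Q : σ → MvPolynomial σ ℂ}

theorem IsPham.norm_zeroCount_sub_traceNF_le (hP : IsPham D P) (hD : 0 < D) (U : Set (σ → ℂ))
    (h : MvPolynomial σ ℂ) {η : ℝ} (H : ∀ z ∈ zeros P, ‖U.indicator 1 z - eval z h‖ ≤ η) :
    ‖(zeroCount P U : ℂ) - hP.traceNF h‖ ≤ D ^ Fintype.card σ * η := by
  classical
  rw [hP.zeroCount_eq hD, hP.traceNF_eq_sum hD, Finset.sum_filter, Nat.cast_sum,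
    ← Finset.sum_sub_distrib]
  refine (norm_sum_le _ _).trans ?_
  rw [← Nat.cast_pow, ← hP.sum_polyMult hD, Nat.cast_sum, Finset.sum_mul]
  refine Finset.sum_le_sum fun z hz => ?_
  have h1 : ((if z ∈ U then polyMult P z else 0 : ℕ) : ℂ) - (polyMult P z : ℂ) * eval z h =
      (polyMult P z : ℂ) * (U.indicator 1 z - eval z h) := by
    by_cases hzU : z ∈ U <;> simp [hzU, mul_sub]
  rw [h1, norm_mul, Complex.norm_natCast]
  exact mul_le_mul_of_nonneg_left (H z (by simpa using hz)) (Nat.cast_nonneg _)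

theorem continuous_eval_pencil (i : σ) :
    Continuous fun p : ℂ × (σ → ℂ) => eval p.2 (pencil P Q p.1 i) := by
  simp only [pencil, map_add, map_mul, eval_C, map_sub]
  have hP := (continuous_eval_mvPolynomial (P i)).comp (continuous_snd (X := ℂ) (Y := σ → ℂ))
  have hQ := (continuous_eval_mvPolynomial (Q i)).comp (continuous_snd (X := ℂ) (Y := σ → ℂ))
  exact hP.add (continuous_fst.mul (hQ.sub hP))

/-- The zeros of a pencil depend upper semicontinuously on the parameter. -/
theorem eventually_zeros_pencil_subset (hD : 0 < D) (hP : IsPham D P) (hQ : IsPham D Q)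
    {W : Set (σ → ℂ)} (hW : IsOpen W) {t₀ : ℂ} (h₀ : zeros (pencil P Q t₀) ⊆ W) :
    ∀ᶠ t in 𝓝 t₀, ‖t‖ ≤ 1 → zeros (pencil P Q t) ⊆ W := by
  obtain ⟨B, hB⟩ := exists_zeros_pencil_bound hD hP hQ
  have key : ∀ᶠ t in 𝓝 t₀, ∀ z ∈ Metric.closedBall (0 : σ → ℂ) B,
      z ∈ zeros (pencil P Q t) → z ∈ W := by
    refine (isCompact_closedBall _ _).eventually_forall_of_forall_eventually fun z _ => ?_
    by_cases hz : z ∈ zeros (pencil P Q t₀)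
    · have h1 : ∀ᶠ p : ℂ × (σ → ℂ) in 𝓝 (t₀, z), p.2 ∈ W :=
        continuous_snd.continuousAt.eventually (hW.mem_nhds (h₀ hz))
      exact h1.mono fun _ h _ => h
    · obtain ⟨i, hi⟩ := not_forall.1 hz
      have h1 : ∀ᶠ p : ℂ × (σ → ℂ) in 𝓝 (t₀, z), eval p.2 (pencil P Q p.1 i) ≠ 0 :=
        (continuous_eval_pencil i).continuousAt.eventually_ne hi
      exact h1.mono fun p hp hp' => absurd (hp' i) hp
  filter_upwards [key] with t ht ht1 z hz
  exact ht z (mem_closedBall_zero_iff.2 (hB t ht1 z hz)) hz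

theorem eventually_zeroCount_pencil_eq (hD : 0 < D) (hP : IsPham D P) (hQ : IsPham D Q)
    {U : Set (σ → ℂ)} (hU : IsOpen U) {t₀ : ℂ}
    (h₀ : ∀ z ∈ frontier U, z ∉ zeros (pencil P Q t₀)) :
    ∀ᶠ t in 𝓝 t₀, ‖t‖ ≤ 1 → zeroCount (pencil P Q t) U = zeroCount (pencil P Q t₀) U := by
  obtain ⟨h, hh⟩ := exists_eval_eq (zeros (pencil P Q t₀)) ((hP.pencil hQ t₀).zeros_finite hD)
    (U.indicator 1)
  set η : ℝ := 1 / (4 * (D ^ Fintype.card σ + 1)) with hη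
  have hη0 : 0 < η := by positivity
  have hη1 : (D : ℝ) ^ Fintype.card σ * η ≤ 1 / 4 := by
    rw [hη, mul_one_div, div_le_div_iff₀ (by positivity) (by norm_num)]
    linarith
  have hc := continuous_eval_mvPolynomial h
  set W : Set (σ → ℂ) := U ∩ {z | ‖1 - eval z h‖ < η} ∪ (closure U)ᶜ ∩ {z | ‖eval z h‖ < η}
  have hW : IsOpen W := (hU.inter (isOpen_lt (by fun_prop) continuous_const)).union
    (isClosed_closure.isOpen_compl.inter (isOpen_lt (by fun_prop) continuous_const))
  have hWη : ∀ z ∈ W, ‖U.indicator 1 z - eval z h‖ ≤ η := by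
    rintro z (⟨hz, hz'⟩ | ⟨hz, hz'⟩)
    · rw [Set.indicator_of_mem hz]
      exact le_of_lt hz'
    · rw [Set.indicator_of_notMem fun hzU => hz (subset_closure hzU), zero_sub, norm_neg]
      exact le_of_lt hz'
  have hW₀ : zeros (pencil P Q t₀) ⊆ W := by
    intro z hz
    by_cases hzU : z ∈ U
    · left
      refine ⟨hzU, ?_⟩
      simp [hh z hz, hzU, hη0]
    · right
      refine ⟨fun hzc => h₀ z ?_ hz, ?_⟩
      · rw [hU.frontier_eq]
        exact ⟨hzc, hzU⟩
      · simp [hh z hz, hzU, hη0]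
  obtain ⟨q, hq⟩ := hP.exists_traceNF_pencil hQ h
  have hqc : ∀ᶠ t in 𝓝 t₀, ‖q.eval t - q.eval t₀‖ < 1 / 4 := by
    have := q.continuous.continuousAt (x := t₀)
    simpa [dist_eq_norm] using this.eventually (Metric.ball_mem_nhds _ (by norm_num : (0:ℝ) < 1 / 4))
  filter_upwards [eventually_zeros_pencil_subset hD hP hQ hW hW₀, hqc] with t ht htq ht1
  have e1 := ((hP.pencil hQ t).norm_zeroCount_sub_traceNF_le hD U h
    fun z hz => hWη z (ht ht1 hz)).trans hη1
  have e2 := ((hP.pencil hQ t₀).norm_zeroCount_sub_traceNF_le hD U h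
    fun z hz => hWη z (hW₀ hz)).trans hη1
  rw [hq] at e1 e2
  have e3 : ‖(zeroCount (pencil P Q t) U : ℂ) - zeroCount (pencil P Q t₀) U‖ < 1 := by
    calc _ = ‖((zeroCount (pencil P Q t) U : ℂ) - q.eval t) + (q.eval t - q.eval t₀) -
          ((zeroCount (pencil P Q t₀) U : ℂ) - q.eval t₀)‖ := by ring_nf
      _ ≤ _ := (norm_sub_le _ _).trans (add_le_add_left (norm_add_le _ _) _)
      _ < 1 := by linarith
  have e4 : ‖(((zeroCount (pencil P Q t) U : ℤ) - zeroCount (pencil P Q t₀) U : ℤ) : ℂ)‖ < 1 := by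
    push_cast
    exact e3
  rw [Complex.norm_intCast, ← Int.cast_abs, ← Int.cast_one, Int.cast_lt, Int.abs_lt_one_iff,
    sub_eq_zero] at e4
  exact_mod_cast e4

/-- The number of zeros in `U` is constant along a pencil without zeros on the boundary of `U`. -/
theorem zeroCount_eq_of_pencil (hD : 0 < D) (hP : IsPham D P) (hQ : IsPham D Q)
    {U : Set (σ → ℂ)} (hU : IsOpen U)
    (h : ∀ t ∈ Set.Icc (0 : ℝ) 1, ∀ z ∈ frontier U, z ∉ zeros (pencil P Q (t : ℂ))) :
    zeroCount P U = zeroCount Q U := by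
  have hn : ∀ t ∈ Set.Icc (0 : ℝ) 1, ‖(t : ℂ)‖ ≤ 1 := fun t ht => by
    rw [Complex.norm_real, Real.norm_of_nonneg ht.1]
    exact ht.2
  have hcont : ContinuousOn (fun t : ℝ => zeroCount (pencil P Q (t : ℂ)) U) (Set.Icc 0 1) := by
    intro t ht
    rw [ContinuousWithinAt, nhds_discrete, tendsto_pure]
    have h1 := Complex.continuous_ofReal.continuousAt.eventually
      (eventually_zeroCount_pencil_eq hD hP hQ hU (h t ht))
    filter_upwards [mem_nhdsWithin_of_mem_nhds h1, self_mem_nhdsWithin] with s hs hs'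
    exact hs (hn s hs')
  have h2 := isPreconnected_Icc.constant hcont (Set.left_mem_Icc.2 zero_le_one)
    (Set.right_mem_Icc.2 zero_le_one)
  have h3 : pencil P Q ((0 : ℝ) : ℂ) = P := funext fun i => by simp [pencil]
  have h4 : pencil P Q ((1 : ℝ) : ℂ) = Q := funext fun i => by simp [pencil]
  simpa only [h3, h4] using h2

/-- Rouché's theorem for polynomial systems with full homogeneous leading terms. -/
theorem zeroCount_eq_of_norm_sub_lt (hD : 0 < D) (hP : IsPham D P) (hQ : IsPham D Q)
    {U : Set (σ → ℂ)} (hU : IsOpen U) (g : (σ → ℂ) → σ → ℂ)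
    (hPg : ∀ z ∈ frontier U, ‖(fun i => eval z (P i)) - g z‖ < ‖g z‖)
    (hQg : ∀ z ∈ frontier U, ‖(fun i => eval z (Q i)) - g z‖ < ‖g z‖) :
    zeroCount P U = zeroCount Q U := by
  refine zeroCount_eq_of_pencil hD hP hQ hU fun t ht z hz hzero => ?_
  have h1 : -g z = (1 - t) • ((fun i => eval z (P i)) - g z) +
      t • ((fun i => eval z (Q i)) - g z) := by
    ext i
    have := hzero i
    simp only [pencil, map_add, map_mul, eval_C, map_sub] at this
    simp only [Pi.neg_apply, Pi.add_apply, Pi.smul_apply, Pi.sub_apply, Complex.real_smul,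
      Complex.ofReal_sub, Complex.ofReal_one]
    linear_combination -this
  have h2 : ‖g z‖ ≤ (1 - t) * ‖(fun i => eval z (P i)) - g z‖ +
      t * ‖(fun i => eval z (Q i)) - g z‖ := by
    rw [← norm_neg (g z), h1]
    refine (norm_add_le _ _).trans_eq ?_
    rw [norm_smul, norm_smul, Real.norm_of_nonneg ht.1, Real.norm_of_nonneg (sub_nonneg.2 ht.2)]
  have h3 := hPg z hz
  have h4 := hQg z hz
  rcases ht.1.eq_or_lt with h0 | h0
  · simp [← h0] at h2
    linarith
  · nlinarith [mul_le_mul_of_nonneg_left h3.le (sub_nonneg.2 ht.2), mul_lt_mul_of_pos_left h4 h0]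

end PathInvariance

section Approximation

variable {σ ι : Type*} [Fintype σ]

/-- The polynomial map defined by a family of polynomials. -/
noncomputable abbrev polyMap (P : ι → MvPolynomial σ ℂ) (x : σ → ℂ) : ι → ℂ :=
  fun i => eval x (P i)

theorem continuous_polyMap (P : ι → MvPolynomial σ ℂ) : Continuous (polyMap P) :=
  continuous_pi fun i => continuous_eval_mvPolynomial (P i)

section PartialSum

variable {G : Type*} [NormedAddCommGroup G] [NormedSpace ℂ G]

theorem exists_polyMap_eq_multilinear {n : ℕ}
    (φ : ContinuousMultilinearMap ℂ (fun _ : Fin n => G) (ι → ℂ)) (L : (σ → ℂ) →ₗ[ℂ] G) (c : G) :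
    ∃ Q : ι → MvPolynomial σ ℂ, ∀ x, polyMap Q x = φ fun _ => L x + c := by
  classical
  let w : Option σ → MvPolynomial σ ℂ := fun o => o.elim 1 X
  let e : Option σ → G := fun o => o.elim c fun i => L fun j => if i = j then 1 else 0
  refine ⟨fun i => ∑ r : Fin n → Option σ, C (φ (fun k => e (r k)) i) * ∏ k, w (r k), fun x => ?_⟩
  have h1 : L x + c = ∑ o, eval x (w o) • e o := by
    rw [Fintype.sum_option, LinearMap.pi_apply_eq_sum_univ, add_comm]
    simp [w, e]
  rw [h1, ContinuousMultilinearMap.map_sum]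
  ext i
  simp only [polyMap, map_sum, map_mul, eval_C, map_prod, Finset.sum_apply]
  refine Finset.sum_congr rfl fun r _ => ?_
  rw [φ.map_smul_univ, Pi.smul_apply, smul_eq_mul, mul_comm]

theorem exists_polyMap_eq_partialSum (p : FormalMultilinearSeries ℂ G (ι → ℂ)) (m : ℕ)
    (L : (σ → ℂ) →ₗ[ℂ] G) (c : G) :
    ∃ Q : ι → MvPolynomial σ ℂ, ∀ x, polyMap Q x = p.partialSum m (L x + c) := by
  choose Q hQ using fun k => exists_polyMap_eq_multilinear (p k) L c
  refine ⟨fun i => ∑ k ∈ Finset.range m, Q k i, fun x => ?_⟩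
  ext i
  simp only [FormalMultilinearSeries.partialSum, Finset.sum_apply, ← hQ, polyMap, map_sum]

end PartialSum

variable [Fintype ι]

/-- Uniform approximability by polynomial maps. -/
def PolyApproxOn (f : (σ → ℂ) → ι → ℂ) (K : Set (σ → ℂ)) : Prop :=
  ∀ ε > 0, ∃ Q : ι → MvPolynomial σ ℂ, ∀ x ∈ K, ‖polyMap Q x - f x‖ < ε

omit [Fintype σ] in
theorem PolyApproxOn.mono {f : (σ → ℂ) → ι → ℂ} {K L : Set (σ → ℂ)} (h : PolyApproxOn f L)
    (hKL : K ⊆ L) : PolyApproxOn f K := fun ε hε =>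
  let ⟨Q, hQ⟩ := h ε hε
  ⟨Q, fun x hx => hQ x (hKL hx)⟩

theorem HasFPowerSeriesOnBall.polyApproxOn {G : Type*} [NormedAddCommGroup G] [NormedSpace ℂ G]
    {F : G → ι → ℂ} {p : FormalMultilinearSeries ℂ G (ι → ℂ)} {a : G} {r : ENNReal}
    (hF : HasFPowerSeriesOnBall F p a r) {r' : NNReal} (hr : (r' : ENNReal) < r)
    (L : (σ → ℂ) →ₗ[ℂ] G) (c : G) {K : Set (σ → ℂ)} (hK : ∀ x ∈ K, L x + c ∈ Metric.ball a r') :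
    PolyApproxOn (fun x => F (L x + c)) K := by
  intro ε hε
  obtain ⟨m, hm⟩ := (Metric.tendstoUniformlyOn_iff.1 (hF.tendstoUniformlyOn' hr) ε hε).exists
  obtain ⟨Q, hQ⟩ := exists_polyMap_eq_partialSum p m L (c - a)
  refine ⟨Q, fun x hx => ?_⟩
  have := hm _ (hK x hx)
  rwa [dist_comm, dist_eq_norm, add_sub_assoc, ← hQ] at this

/-- Taylor polynomials: approximation uniformly near `z` and to any order at `z`. -/
theorem AnalyticAt.exists_taylor {f : (σ → ℂ) → ι → ℂ} {z : σ → ℂ} (hf : AnalyticAt ℂ f z) :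
    ∃ r > 0, ∃ Q : ℕ → ι → MvPolynomial σ ℂ,
      (∀ ε > 0, ∀ᶠ m in atTop, ∀ x ∈ Metric.ball z r, ‖polyMap (Q m) x - f x‖ < ε) ∧
      ∀ m, (fun x => f x - polyMap (Q m) x) =O[𝓝 z] fun x => ‖x - z‖ ^ m := by
  obtain ⟨p, R, hp⟩ := hf
  obtain ⟨r, hr0, hr⟩ := ENNReal.lt_iff_exists_nnreal_btwn.1 hp.r_pos
  choose Q hQ using fun m => exists_polyMap_eq_partialSum p m (LinearMap.id (M := σ → ℂ)) (-z)
  simp only [LinearMap.id_apply, ← sub_eq_add_neg] at hQ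
  refine ⟨r, by exact_mod_cast hr0, Q, fun ε hε => ?_, fun m => ?_⟩
  · filter_upwards [Metric.tendstoUniformlyOn_iff.1 (hp.tendstoUniformlyOn' hr) ε hε] with m hm x hx
    rw [hQ, ← dist_eq_norm, dist_comm]
    exact hm x hx
  · have h1 := (HasFPowerSeriesOnBall.hasFPowerSeriesAt hp).isBigO_sub_partialSum_pow m
    have h2 : Tendsto (fun x : σ → ℂ => x - z) (𝓝 z) (𝓝 0) := by
      simpa using (continuous_id.sub continuous_const).tendsto (x := z) (f := fun x : σ → ℂ => x - z)
    have h3 := h1.comp_tendsto h2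
    simpa only [Function.comp_def, add_sub_cancel, ← hQ] using h3

end Approximation

section Bump

variable {σ : Type*} [Fintype σ]

/-- Adding powers `(x i - z i) ^ D` to a system to give it full leading terms. -/
noncomputable def addPowers (Q : σ → MvPolynomial σ ℂ) (z : σ → ℂ) (D : ℕ) (i : σ) :
    MvPolynomial σ ℂ :=
  Q i + (X i - C (z i)) ^ D

omit [Fintype σ] in
theorem hasLead_X_sub_C (z : σ → ℂ) (i : σ) :
    HasLead (X i - C (z i)) (Finsupp.single i 1) := by
  have h := (degLT σ ℂ 1).neg_mem (monomial_mem_degLT (R := ℂ) (γ := (0 : σ →₀ ℕ)) (d := 1)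
    (by simp) (z i))
  rw [HasLead, Finsupp.degree_single]
  convert h using 1
  rw [← C_apply, ← X]
  ring

theorem eventually_mem_degLT (Q : σ → MvPolynomial σ ℂ) :
    ∀ᶠ D in atTop, ∀ i, Q i ∈ degLT σ ℂ D := by
  rw [eventually_all]
  intro i
  obtain ⟨d, hd⟩ := exists_mem_degLT (Q i)
  filter_upwards [eventually_ge_atTop d] with D hD
  exact degLT_mono hD hd

omit [Fintype σ] in
theorem IsPham.add {D : ℕ} {P Q : σ → MvPolynomial σ ℂ} (hP : IsPham D P)
    (hQ : ∀ i, Q i ∈ degLT σ ℂ D) : IsPham D fun i => P i + Q i := by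
  intro i
  have h := (degLT σ ℂ _).add_mem (hP i) (by simpa using hQ i)
  rw [HasLead]
  convert h using 1
  ring

theorem eventually_isPham_addPowers (Q : σ → MvPolynomial σ ℂ) (z : σ → ℂ) :
    ∀ᶠ D in atTop, IsPham D (addPowers Q z D) := by
  filter_upwards [eventually_mem_degLT Q] with D hD
  have h : IsPham D fun i => (X i - C (z i)) ^ D := fun i => by
    simpa using (hasLead_X_sub_C z i).pow D
  have h' := h.add hD
  simp only [add_comm _ (Q _)] at h'
  exact h'

theorem norm_polyMap_addPowers_sub_le (Q : σ → MvPolynomial σ ℂ) (z : σ → ℂ) (D : ℕ)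
    (x : σ → ℂ) : ‖polyMap (addPowers Q z D) x - polyMap Q x‖ ≤ ‖x - z‖ ^ D := by
  refine (pi_norm_le_iff_of_nonneg (by positivity)).2 fun i => ?_
  simp only [polyMap, addPowers, Pi.sub_apply, map_add, map_pow, map_sub, eval_X, eval_C,
    add_sub_cancel_left, norm_pow]
  exact pow_le_pow_left₀ (norm_nonneg _) (norm_le_pi_norm (x - z) i) _

theorem eventually_norm_addPowers_sub_lt (Q : σ → MvPolynomial σ ℂ) {z : σ → ℂ} {ρ ε : ℝ}
    (hρ : ρ < 1) (hε : 0 < ε) : ∀ᶠ D in atTop, ∀ x ∈ Metric.closedBall z ρ,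
      ‖polyMap (addPowers Q z D) x - polyMap Q x‖ < ε := by
  by_cases hρ0 : 0 ≤ ρ
  · filter_upwards [(tendsto_pow_atTop_nhds_zero_of_lt_one hρ0 hρ).eventually_lt_const hε]
      with D hD x hx
    refine (norm_polyMap_addPowers_sub_le Q z D x).trans_lt (lt_of_le_of_lt ?_ hD)
    exact pow_le_pow_left₀ (norm_nonneg _) (mem_closedBall_iff_norm.1 hx) _
  · refine Eventually.of_forall fun D x hx => ?_
    rw [Metric.closedBall_eq_empty.2 (not_le.1 hρ0)] at hx
    exact hx.elim

theorem PolyApproxOn.eventually_exists_isPham {f : (σ → ℂ) → σ → ℂ} {K : Set (σ → ℂ)}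
    (hf : PolyApproxOn f K) {z : σ → ℂ} {ρ : ℝ} (hρ : ρ < 1) (hK : K ⊆ Metric.closedBall z ρ)
    {ε : ℝ} (hε : 0 < ε) :
    ∀ᶠ D in atTop, ∃ P, IsPham D P ∧ ∀ x ∈ K, ‖polyMap P x - f x‖ < ε := by
  obtain ⟨Q, hQ⟩ := hf (ε / 2) (half_pos hε)
  filter_upwards [eventually_isPham_addPowers Q z,
    eventually_norm_addPowers_sub_lt Q hρ (half_pos hε)] with D hD hD'
  refine ⟨_, hD, fun x hx => ?_⟩
  have := norm_sub_le_norm_sub_add_norm_sub (polyMap (addPowers Q z D) x) (polyMap Q x) (f x)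
  linarith [hD' x (hK hx), hQ x hx]

end Bump

section HasCount

variable {σ : Type*} [Fintype σ]

/-- Every system of polynomials with full leading terms of large degree that is close enough to `f`
on the closure of `U` has exactly `N` zeros in `U`, counted with multiplicity. -/
def HasCount (f : (σ → ℂ) → σ → ℂ) (U : Set (σ → ℂ)) (N : ℕ) : Prop :=
  ∃ ε > 0, ∀ᶠ D in atTop, ∀ P, IsPham D P →
    (∀ x ∈ closure U, ‖polyMap P x - f x‖ < ε) → zeroCount P U = N

theorem HasCount.exists_forall_close {f : (σ → ℂ) → σ → ℂ} {U : Set (σ → ℂ)} {N : ℕ}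
    (h : HasCount f U N) :
    ∃ ε > 0, ∀ g : (σ → ℂ) → σ → ℂ, (∀ x ∈ closure U, ‖g x - f x‖ < ε) → HasCount g U N := by
  obtain ⟨ε, hε, h⟩ := h
  refine ⟨ε / 2, half_pos hε, fun g hg => ⟨ε / 2, half_pos hε, ?_⟩⟩
  filter_upwards [h] with D hD P hP hPg
  refine hD P hP fun x hx => ?_
  have := norm_sub_le_norm_sub_add_norm_sub (polyMap P x) (g x) (f x)
  linarith [hg x hx, hPg x hx]

theorem HasCount.unique {f : (σ → ℂ) → σ → ℂ} {U : Set (σ → ℂ)} {N N' : ℕ}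
    (h : HasCount f U N) (h' : HasCount f U N') (hf : PolyApproxOn f (closure U)) {z : σ → ℂ}
    {ρ : ℝ} (hρ : ρ < 1) (hU : closure U ⊆ Metric.closedBall z ρ) : N = N' := by
  obtain ⟨ε, hε, h⟩ := h
  obtain ⟨ε', hε', h'⟩ := h'
  obtain ⟨D, hD, hD', P, hP, hPf⟩ := (h.and (h'.and
    (hf.eventually_exists_isPham hρ hU (lt_min hε hε')))).exists
  rw [← hD P hP fun x hx => (hPf x hx).trans_le (min_le_left _ _)]
  exact hD' P hP fun x hx => (hPf x hx).trans_le (min_le_right _ _)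

/-- Near an isolated zero of finite multiplicity, the number of zeros is the multiplicity. -/
theorem eventually_hasCount_ball {f : (σ → ℂ) → σ → ℂ} {z : σ → ℂ} (hf : AnalyticAt ℂ f z)
    (hz : f z = 0) (hfin : Module.Finite ℂ (analyticGermsAt z ⧸ solIdeal z fun i x => f x i)) :
    ∀ᶠ ρ in 𝓝[>] (0 : ℝ), HasCount f (Metric.ball z ρ) (solMultiplicity z fun i x => f x i) := by
  have hfi : ∀ i, AnalyticAt ℂ (fun x => f x i) z := analyticAt_pi_iff.1 hf
  obtain ⟨k, hk⟩ : ∃ k, germMax z ^ k ≤ solIdeal z fun i x => f x i :=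
    ⟨_, pow_le_of_finrank_le (germMax_le_jacobson z) hfin le_rfl⟩
  obtain ⟨a, ha, hfa⟩ := exists_norm_ge_of_pow_le hfi hk
  obtain ⟨-, -, Q, -, hQ⟩ := hf.exists_taylor
  obtain ⟨c, hc0, hc⟩ := (hQ (k + 1)).exists_pos
  obtain ⟨r₁, hr₁, hr₁'⟩ := Metric.eventually_nhds_iff.1 (hfa.and hc.bound)
  have hlt : ∀ b > 0, ∀ᶠ ρ in 𝓝[>] (0 : ℝ), ρ < b := fun b hb =>
    mem_nhdsWithin_of_mem_nhds (Iio_mem_nhds hb)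
  filter_upwards [hlt r₁ hr₁, hlt 1 one_pos, hlt (a / (4 * c)) (by positivity),
    self_mem_nhdsWithin] with ρ hρr hρ1 hρc hρ0
  replace hρ0 : 0 < ρ := hρ0
  rw [lt_div_iff₀ (by positivity)] at hρc
  have hfρ : ∀ x ∈ Metric.closedBall z ρ, a * ‖x - z‖ ^ k ≤ ‖f x‖ := fun x hx =>
    (hr₁' (lt_of_le_of_lt hx hρr)).1
  have hQρ : ∀ x ∈ Metric.closedBall z ρ,
      ‖polyMap (Q (k + 1)) x - f x‖ ≤ c * ‖x - z‖ ^ (k + 1) := fun x hx => by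
    have := (hr₁' (lt_of_le_of_lt hx hρr)).2
    rwa [norm_sub_rev, norm_pow, norm_norm] at this
  refine ⟨a / 2 * ρ ^ k, by positivity, ?_⟩
  have hpow : ∀ᶠ j in atTop, ρ ^ j < a / 4 :=
    (tendsto_pow_atTop_nhds_zero_of_lt_one hρ0.le hρ1).eventually_lt_const (by positivity)
  filter_upwards [eventually_isPham_addPowers (Q (k + 1)) z, eventually_ge_atTop (k + 1),
    (tendsto_sub_atTop_nat k).eventually hpow] with D hR hDk hDρ P hP hPf
  set R := addPowers (Q (k + 1)) z D with hRdef
  have hD : 0 < D := by omega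
  have hRf : ∀ x ∈ Metric.closedBall z ρ, ‖polyMap R x - f x‖ ≤ a / 2 * ‖x - z‖ ^ k := by
    intro x hx
    have hxz : ‖x - z‖ ≤ ρ := mem_closedBall_iff_norm.1 hx
    have h1 := norm_polyMap_addPowers_sub_le (Q (k + 1)) z D x
    have h2 : ‖x - z‖ ^ D ≤ a / 4 * ‖x - z‖ ^ k := by
      rw [← Nat.sub_add_cancel (show k ≤ D by omega), pow_add]
      exact mul_le_mul_of_nonneg_right
        ((pow_le_pow_left₀ (norm_nonneg _) hxz _).trans hDρ.le) (by positivity)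
    have h3 : c * ‖x - z‖ ^ (k + 1) ≤ a / 4 * ‖x - z‖ ^ k := by
      rw [pow_succ', ← mul_assoc]
      refine mul_le_mul_of_nonneg_right ?_ (by positivity)
      nlinarith
    have h4 := norm_sub_le_norm_sub_add_norm_sub (polyMap R x) (polyMap (Q (k + 1)) x) (f x)
    linarith [hQρ x hx]
  have hRz : z ∈ zeros R := by
    have h1 := hQρ z (Metric.mem_closedBall_self hρ0.le)
    have h2 := norm_polyMap_addPowers_sub_le (Q (k + 1)) z D z
    rw [sub_self, norm_zero, zero_pow (by omega)] at h1 h2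
    rw [hz, mul_zero, sub_zero, norm_le_zero_iff] at h1
    rw [h1, sub_zero, norm_le_zero_iff] at h2
    exact fun i => congrFun h2 i
  have hzeros : zeros R ∩ Metric.ball z ρ = {z} := by
    refine Set.eq_singleton_iff_unique_mem.2 ⟨⟨hRz, Metric.mem_ball_self hρ0⟩, ?_⟩
    rintro x ⟨hx, hxρ⟩
    have h1 := hRf x (Metric.ball_subset_closedBall hxρ)
    have h2 := hfρ x (Metric.ball_subset_closedBall hxρ)
    have h3 : polyMap R x = 0 := funext hx
    rw [h3, zero_sub, norm_neg] at h1
    by_contra hxz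
    have h4 : 0 < ‖x - z‖ ^ k := pow_pos (norm_pos_iff.2 (sub_ne_zero.2 hxz)) _
    nlinarith
  have hmult : solIdeal z (fun i x => eval x (R i)) = solIdeal z fun i x => f x i := by
    refine solIdeal_eq_of_isBigO hfi (fun i => analyticAt_eval _ _) hk fun i => ?_
    have h1 : (fun x => f x - polyMap R x) =O[𝓝 z] fun x => ‖x - z‖ ^ (k + 1) := by
      have h2 : (fun x => polyMap R x - polyMap (Q (k + 1)) x) =O[𝓝 z]
          fun x => ‖x - z‖ ^ (k + 1) := by
        refine Asymptotics.IsBigO.of_bound 1 ?_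
        filter_upwards [Metric.ball_mem_nhds z one_pos] with x hx
        refine (norm_polyMap_addPowers_sub_le _ _ _ _).trans ?_
        rw [one_mul, norm_pow, norm_norm]
        exact pow_le_pow_of_le_one (norm_nonneg _) (mem_ball_iff_norm.1 hx).le hDk
      simpa using (hQ (k + 1)).sub h2
    exact (Asymptotics.isBigO_pi.1 h1) i
  have hcount : zeroCount R (Metric.ball z ρ) = solMultiplicity z fun i x => f x i := by
    rw [zeroCount, hzeros, finsum_mem_singleton, polyMult, solMultiplicity_eq, solMultiplicity_eq,
      hmult]
  rw [← hcount]
  have hfr : ∀ x ∈ frontier (Metric.ball z ρ), ‖x - z‖ = ρ := fun x hx =>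
    mem_sphere_iff_norm.1 (Metric.frontier_ball_subset_sphere hx)
  refine zeroCount_eq_of_norm_sub_lt hD hP hR Metric.isOpen_ball f (fun x hx => ?_) fun x hx => ?_
  all_goals
    have h0 := hfr x hx
    have h1 := hfρ x (mem_closedBall_iff_norm.2 h0.le)
    rw [h0] at h1
    have h2 : 0 < a * ρ ^ k := by positivity
  · have h3 := hPf x (frontier_subset_closure hx)
    refine h3.trans_le (le_trans ?_ h1)
    linarith
  · have h3 := hRf x (mem_closedBall_iff_norm.2 h0.le)
    rw [h0] at h3
    exact h3.trans_lt (by linarith)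

theorem IsCompact.exists_pos_forall_le_norm {α F : Type*} [TopologicalSpace α]
    [NormedAddCommGroup F] {K : Set α} (hK : IsCompact K) {f : α → F} (hf : ContinuousOn f K)
    (h : ∀ x ∈ K, f x ≠ 0) : ∃ δ > 0, ∀ x ∈ K, δ ≤ ‖f x‖ := by
  rcases K.eq_empty_or_nonempty with rfl | hne
  · exact ⟨1, one_pos, by simp⟩
  · obtain ⟨x, hx, hmin⟩ := hK.exists_isMinOn hne hf.norm
    exact ⟨‖f x‖, norm_pos_iff.2 (h x hx), fun y hy => hmin hy⟩

/-- Local counts at the zeros add up to a global count. -/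
theorem hasCount_of_eventually_hasCount_ball {f : (σ → ℂ) → σ → ℂ} {U S : Set (σ → ℂ)}
    (hU : IsOpen U) (hUb : Bornology.IsBounded U) (hf : ContinuousOn f (closure U))
    (hS : S.Finite) (hSU : S ⊆ U) (hSf : ∀ x ∈ closure U, f x = 0 → x ∈ S)
    {N : (σ → ℂ) → ℕ} (hN : ∀ z ∈ S, ∀ᶠ ρ in 𝓝[>] (0 : ℝ), HasCount f (Metric.ball z ρ) (N z)) :
    HasCount f U (∑ᶠ z ∈ S, N z) := by
  have hlt : ∀ b > 0, ∀ᶠ ρ in 𝓝[>] (0 : ℝ), ρ < b := fun b hb =>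
    mem_nhdsWithin_of_mem_nhds (Iio_mem_nhds hb)
  have hball : ∀ z ∈ S, ∀ᶠ ρ in 𝓝[>] (0 : ℝ), Metric.ball z ρ ⊆ U := fun z hz => by
    obtain ⟨r, hr, hr'⟩ := Metric.isOpen_iff.1 hU z (hSU hz)
    filter_upwards [hlt r hr] with ρ hρ
    exact (Metric.ball_subset_ball hρ.le).trans hr'
  have hdisj : ∀ z ∈ S, ∀ w ∈ S, ∀ᶠ ρ in 𝓝[>] (0 : ℝ),
      z ≠ w → Disjoint (Metric.ball z ρ) (Metric.ball w ρ) := fun z _ w _ => by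
    by_cases hzw : z = w
    · simp [hzw]
    · filter_upwards [hlt (dist z w / 2) (half_pos (dist_pos.2 hzw))] with ρ hρ _
      exact Metric.ball_disjoint_ball (by linarith)
  obtain ⟨ρ, hρ1, hρ2, hρ3, hρ0⟩ := (((hS.eventually_all).2 hN).and
    (((hS.eventually_all).2 hball).and (((hS.eventually_all).2 fun z hz =>
      (hS.eventually_all).2 (hdisj z hz)).and self_mem_nhdsWithin))).exists
  replace hρ0 : 0 < ρ := hρ0
  choose! ε hε hεN using hρ1
  obtain ⟨ε₀, hε₀, hε₀S⟩ : ∃ ε₀ > 0, ∀ z ∈ S, ε₀ ≤ ε z := by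
    rcases S.eq_empty_or_nonempty with rfl | hne
    · exact ⟨1, one_pos, by simp⟩
    · obtain ⟨z, hz, hmin⟩ := Set.exists_min_image S ε hS hne
      exact ⟨ε z, hε z hz, hmin⟩
  set B : Set (σ → ℂ) := ⋃ z ∈ S, Metric.ball z ρ with hB
  have hBopen : IsOpen B := isOpen_biUnion fun _ _ => Metric.isOpen_ball
  obtain ⟨δ, hδ, hδf⟩ := (hUb.isCompact_closure.diff hBopen).exists_pos_forall_le_norm
    (hf.mono Set.sdiff_subset) fun x hx h0 =>
      hx.2 (Set.mem_biUnion (hSf x hx.1 h0) (Metric.mem_ball_self hρ0))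
  refine ⟨min ε₀ δ, lt_min hε₀ hδ, ?_⟩
  filter_upwards [(hS.eventually_all).2 hεN, eventually_gt_atTop 0] with D hD hD0 P hP hPf
  have hset : zeros P ∩ U = ⋃ z ∈ S, zeros P ∩ Metric.ball z ρ := by
    rw [← Set.inter_iUnion₂]
    refine Set.Subset.antisymm (fun x hx => ⟨hx.1, ?_⟩) fun x hx => ⟨hx.1, ?_⟩
    · by_contra hxB
      have h1 := hPf x (subset_closure hx.2)
      have h2 := hδf x ⟨subset_closure hx.2, hxB⟩
      have h3 : polyMap P x = 0 := funext hx.1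
      rw [h3, zero_sub, norm_neg] at h1
      exact absurd (h1.trans_le (min_le_right _ _)) (not_lt.2 h2)
    · obtain ⟨z, hz, hxz⟩ := Set.mem_iUnion₂.1 hx.2
      exact hρ2 z hz hxz
  rw [zeroCount, hset, finsum_mem_biUnion (fun z hz w hw hzw =>
    (hρ3 z hz w hw hzw).mono Set.inter_subset_right Set.inter_subset_right) hS
    fun z _ => (hP.zeros_finite hD0).inter_of_left _]
  refine finsum_mem_congr rfl fun z hz => ?_
  exact hD z hz P hP fun x hx => (hPf x (closure_mono (hρ2 z hz) hx)).trans_le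
    ((min_le_left _ _).trans (hε₀S z hz))

theorem IsPham.hasCount {D : ℕ} {P : σ → MvPolynomial σ ℂ} (hP : IsPham D P) (hD : 0 < D)
    {U : Set (σ → ℂ)} (hU : IsOpen U) (hUb : Bornology.IsBounded U)
    (h : ∀ x ∈ frontier U, x ∉ zeros P) : HasCount (polyMap P) U (zeroCount P U) := by
  refine hasCount_of_eventually_hasCount_ball hU hUb (continuous_polyMap P).continuousOn
    ((hP.zeros_finite hD).inter_of_left U) Set.inter_subset_right (fun x hx h0 => ?_) fun z hz => ?_
  · have hxP : x ∈ zeros P := fun i => congrFun h0 i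
    refine ⟨hxP, ?_⟩
    by_contra hxU
    exact h x (hU.frontier_eq ▸ ⟨hx, hxU⟩) hxP
  · exact eventually_hasCount_ball (analyticAt_pi_iff.2 fun i => analyticAt_eval _ _)
      (funext hz.1) (hP.finite_quotient_polyIdeal hD hz.1)

/-- A polynomially approximable map without zeros on the boundary has a well-defined count. -/
theorem PolyApproxOn.exists_hasCount {f : (σ → ℂ) → σ → ℂ} {U : Set (σ → ℂ)}
    (hf : PolyApproxOn f (closure U)) (hU : IsOpen U) {z : σ → ℂ} {ρ : ℝ} (hρ : ρ < 1)
    (hUz : closure U ⊆ Metric.closedBall z ρ) (hfc : ContinuousOn f (frontier U))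
    (hf0 : ∀ x ∈ frontier U, f x ≠ 0) : ∃ N, HasCount f U N := by
  have hUb : Bornology.IsBounded U :=
    Metric.isBounded_closedBall.subset (subset_closure.trans hUz)
  have hfr : IsCompact (frontier U) :=
    hUb.isCompact_closure.of_isClosed_subset isClosed_frontier frontier_subset_closure
  obtain ⟨δ, hδ, hδf⟩ := hfr.exists_pos_forall_le_norm hfc hf0
  obtain ⟨D₀, ⟨P₀, hP₀, hP₀f⟩, hD₀⟩ := ((hf.eventually_exists_isPham hρ hUz (half_pos hδ)).and
    (eventually_gt_atTop 0)).exists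
  have hP₀0 : ∀ x ∈ frontier U, x ∉ zeros P₀ := fun x hx h0 => by
    have h1 := hP₀f x (frontier_subset_closure hx)
    have h2 : polyMap P₀ x = 0 := funext h0
    rw [h2, zero_sub, norm_neg] at h1
    linarith [hδf x hx]
  obtain ⟨ε, hε, hN⟩ := hP₀.hasCount hD₀ hU hUb hP₀0
  refine ⟨zeroCount P₀ U, δ, hδ, ?_⟩
  filter_upwards [hN, eventually_isPham_addPowers P₀ z,
    eventually_norm_addPowers_sub_lt P₀ hρ (lt_min hε (half_pos hδ)), eventually_gt_atTop 0]
    with D hD hR hRP hD0 P hP hPf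
  rw [← hD _ hR fun x hx => (hRP x (hUz hx)).trans_le (min_le_left _ _)]
  refine zeroCount_eq_of_norm_sub_lt hD0 hP hR hU f
    (fun x hx => (hPf x (frontier_subset_closure hx)).trans_le (hδf x hx)) fun x hx => ?_
  have hx' := frontier_subset_closure hx
  have h1 := norm_sub_le_norm_sub_add_norm_sub (polyMap (addPowers P₀ z D) x) (polyMap P₀ x) (f x)
  have h2 := (hRP x (hUz hx')).trans_le (min_le_right _ _)
  exact h1.trans_lt (by linarith [hP₀f x hx', hδf x hx])

end HasCount

section Bounds

variable {σ : Type*} [Fintype σ]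

/-- The number of distinct zeros is at most the count with multiplicities. -/
theorem HasCount.card_le {f : (σ → ℂ) → σ → ℂ} {U : Set (σ → ℂ)} {N : ℕ} (h : HasCount f U N)
    (hf : PolyApproxOn f (closure U)) {z : σ → ℂ} {ρ : ℝ} (hρ : ρ < 1)
    (hU : closure U ⊆ Metric.closedBall z ρ) {T : Finset (σ → ℂ)}
    (hT : ∀ w ∈ T, w ∈ U ∧ f w = 0) : T.card ≤ N := by
  classical
  choose L hL using fun w => exists_eval_eq (T : Set (σ → ℂ)) T.finite_toSet (Pi.single w 1)
  have hK : IsCompact (closure U) :=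
    (isCompact_closedBall z ρ).of_isClosed_subset isClosed_closure hU
  choose M hM using fun w =>
    hK.exists_bound_of_continuousOn (continuous_eval_mvPolynomial (L w)).continuousOn
  have hMnn : 0 ≤ ∑ w ∈ T, |M w| := Finset.sum_nonneg fun _ _ => abs_nonneg _
  obtain ⟨ε, hε, hN⟩ := h
  have hε' : 0 < ε / (1 + ∑ w ∈ T, |M w|) := by positivity
  have hLD : ∀ᶠ D in atTop, ∀ w ∈ T, L w ∈ degLT σ ℂ D := by
    refine (T.eventually_all).2 fun w _ => ?_
    obtain ⟨d, hd⟩ := exists_mem_degLT (L w)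
    filter_upwards [eventually_ge_atTop d] with D hD
    exact degLT_mono hD hd
  obtain ⟨D, hD, ⟨P, hP, hPf⟩, hLD, hD0⟩ := (hN.and ((hf.eventually_exists_isPham hρ hU hε').and
    (hLD.and (eventually_gt_atTop 0)))).exists
  set R : σ → MvPolynomial σ ℂ := fun i => -∑ w ∈ T, eval w (P i) • L w with hR
  have hPR : IsPham D fun i => P i + R i := hP.add fun i =>
    (degLT σ ℂ D).neg_mem ((degLT σ ℂ D).sum_mem fun w hw => (degLT σ ℂ D).smul_mem _ (hLD w hw))
  have hT0 : ∀ w ∈ T, w ∈ zeros fun i => P i + R i := by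
    intro w hw i
    have h1 : ∀ v ∈ T, eval v (P i) * eval w (L v) = if v = w then eval w (P i) else 0 := by
      intro v hv
      rw [hL v w hw, Pi.single_apply]
      by_cases hvw : v = w
      · simp [hvw]
      · simp [hvw, Ne.symm hvw]
    simp only [hR, map_add, map_neg, map_sum, smul_eval]
    rw [Finset.sum_congr rfl h1, Finset.sum_ite_eq' T w, if_pos hw, add_neg_cancel]
  have hclose : ∀ x ∈ closure U, ‖polyMap (fun i => P i + R i) x - f x‖ < ε := by
    intro x hx
    have h1 : ‖polyMap R x‖ ≤ ε / (1 + ∑ w ∈ T, |M w|) * ∑ w ∈ T, |M w| := by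
      refine (pi_norm_le_iff_of_nonneg (by positivity)).2 fun i => ?_
      simp only [polyMap, hR, map_neg, map_sum, norm_neg, smul_eval, Finset.mul_sum]
      refine (norm_sum_le _ _).trans (Finset.sum_le_sum fun w hw => ?_)
      rw [norm_mul]
      refine mul_le_mul ?_ ((hM w x hx).trans (le_abs_self _)) (norm_nonneg _) hε'.le
      have h2 := hPf w (subset_closure (hT w hw).1)
      rw [(hT w hw).2, sub_zero] at h2
      exact (norm_le_pi_norm (polyMap P w) i).trans h2.le
    have h2 : polyMap (fun i => P i + R i) x - f x = (polyMap P x - f x) + polyMap R x := by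
      ext i
      simp only [polyMap, Pi.sub_apply, Pi.add_apply, map_add]
      ring
    rw [h2]
    calc _ ≤ _ := norm_add_le _ _
      _ < ε / (1 + ∑ w ∈ T, |M w|) + ε / (1 + ∑ w ∈ T, |M w|) * ∑ w ∈ T, |M w| :=
          add_lt_add_of_lt_of_le (hPf x hx) h1
      _ = ε := by field_simp
  rw [← hD _ hPR hclose, hPR.zeroCount_eq hD0, Finset.card_eq_sum_ones]
  calc ∑ w ∈ T, 1 ≤ ∑ w ∈ T, polyMult (fun i => P i + R i) w :=
        Finset.sum_le_sum fun w hw => one_le_solMultiplicity (hT0 w hw)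
          (hPR.finite_quotient_polyIdeal hD0 (hT0 w hw))
    _ ≤ _ := Finset.sum_le_sum_of_subset fun w hw => by
        simpa using ⟨hT0 w hw, (hT w hw).1⟩

/-- The multiplicity of an isolated zero is finite. -/
theorem finite_quotient_of_isolated {f : (σ → ℂ) → σ → ℂ} {z : σ → ℂ} (hf : AnalyticAt ℂ f z)
    (hz : f z = 0) (hiso : ∀ᶠ x in 𝓝 z, f x = 0 → x = z) :
    Module.Finite ℂ (analyticGermsAt z ⧸ solIdeal z fun i x => f x i) := by
  obtain ⟨r, hr, Q, hQ, hQO⟩ := hf.exists_taylor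
  obtain ⟨r', hr', hr''⟩ := Metric.eventually_nhds_iff.1 (hiso.and hf.eventually_analyticAt)
  obtain ⟨ρ, hρ0, hρ⟩ := exists_between (lt_min (lt_min hr hr') one_pos)
  obtain ⟨⟨hρr, hρr'⟩, hρ1⟩ := (lt_min_iff.1 hρ).imp_left lt_min_iff.1
  have hcl : closure (Metric.ball z ρ) ⊆ Metric.closedBall z ρ := Metric.closure_ball_subset_closedBall
  have happ : PolyApproxOn f (closure (Metric.ball z ρ)) := fun ε hε => by
    obtain ⟨m, hm⟩ := (hQ ε hε).exists
    exact ⟨Q m, fun x hx => hm x (lt_of_le_of_lt (hcl hx) hρr)⟩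
  have hfr : ∀ x ∈ frontier (Metric.ball z ρ), dist x z = ρ := fun x hx =>
    Metric.frontier_ball_subset_sphere hx
  obtain ⟨N, ε, hε, hN⟩ := happ.exists_hasCount Metric.isOpen_ball hρ1 hcl
    (fun x hx => (hr'' ((hfr x hx).trans_lt hρr')).2.continuousAt.continuousWithinAt)
    fun x hx h0 => by
      have h1 := hfr x hx
      rw [(hr'' (h1.trans_lt hρr')).1 h0, dist_self] at h1
      exact hρ0.ne h1
  obtain ⟨m, hm, hmN⟩ := ((hQ (ε / 2) (half_pos hε)).and (eventually_ge_atTop (N + 1))).exists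
  obtain ⟨D, hD, hR, hRQ, hDN⟩ := (hN.and ((eventually_isPham_addPowers (Q m) z).and
    ((eventually_norm_addPowers_sub_lt (Q m) hρ1 (half_pos hε)).and
    (eventually_ge_atTop (N + 1))))).exists
  set R := addPowers (Q m) z D with hRdef
  have hD0 : 0 < D := by omega
  have hRO : (fun x => polyMap R x - f x) =O[𝓝 z] fun x => ‖x - z‖ ^ (N + 1) := by
    have hpow : ∀ {j : ℕ}, N + 1 ≤ j → ∀ᶠ x in 𝓝 z, ‖x - z‖ ^ j ≤ ‖x - z‖ ^ (N + 1) := by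
      intro j hj
      filter_upwards [Metric.ball_mem_nhds z one_pos] with x hx
      exact pow_le_pow_of_le_one (norm_nonneg _) (mem_ball_iff_norm.1 hx).le hj
    have h1 : (fun x => polyMap R x - polyMap (Q m) x) =O[𝓝 z] fun x => ‖x - z‖ ^ (N + 1) := by
      refine Asymptotics.IsBigO.of_bound 1 ?_
      filter_upwards [hpow hDN] with x hx
      rw [one_mul, norm_pow, norm_norm]
      exact (norm_polyMap_addPowers_sub_le _ _ _ _).trans hx
    have h2 : (fun x : σ → ℂ => ‖x - z‖ ^ m) =O[𝓝 z] fun x => ‖x - z‖ ^ (N + 1) := by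
      refine Asymptotics.IsBigO.of_bound 1 ?_
      filter_upwards [hpow hmN] with x hx
      simpa using hx
    simpa using h1.sub ((hQO m).trans h2)
  have hRz : z ∈ zeros R := by
    have h1 : polyMap R z - f z = 0 := by
      have := hRO.eq_zero_imp.self_of_nhds
      exact this (by simp)
    rw [hz, sub_zero] at h1
    exact fun i => congrFun h1 i
  have hRN : zeroCount R (Metric.ball z ρ) = N := by
    refine hD R hR fun x hx => ?_
    have h1 := norm_sub_le_norm_sub_add_norm_sub (polyMap R x) (polyMap (Q m) x) (f x)
    linarith [hRQ x (hcl hx), hm x (lt_of_le_of_lt (hcl hx) hρr)]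
  have hle : polyMult R z ≤ N := by
    classical
    rw [← hRN, hR.zeroCount_eq hD0]
    refine Finset.single_le_sum (f := fun z => polyMult R z) (fun _ _ => Nat.zero_le _) ?_
    simpa using ⟨hRz, hρ0⟩
  have hfin := hR.finite_quotient_polyIdeal hD0 hRz
  have heq := solIdeal_eq_of_isBigO (fun i => analyticAt_eval (R i) z) (analyticAt_pi_iff.1 hf)
    (pow_le_of_finrank_le (germMax_le_jacobson z) hfin hle) (Asymptotics.isBigO_pi.1 hRO)
  rw [heq]
  exact hfin

/-- The sum of the multiplicities of the zeros in `U` is the count of zeros. -/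
theorem HasCount.finite_and_finsum_eq {f : (σ → ℂ) → σ → ℂ} {U : Set (σ → ℂ)} {N : ℕ}
    (h : HasCount f U N) (hU : IsOpen U) (hf : ∀ x ∈ closure U, AnalyticAt ℂ f x)
    (hf0 : ∀ x ∈ frontier U, f x ≠ 0) (happ : PolyApproxOn f (closure U)) {z : σ → ℂ} {ρ : ℝ}
    (hρ : ρ < 1) (hUz : closure U ⊆ Metric.closedBall z ρ) :
    {x ∈ U | f x = 0}.Finite ∧
      ∑ᶠ x ∈ {x ∈ U | f x = 0}, solMultiplicity x (fun i x => f x i) = N := by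
  set S := {x ∈ U | f x = 0} with hSdef
  have hS : S.Finite := by
    by_contra hS
    obtain ⟨T, hTS, hT⟩ := Set.Infinite.exists_subset_card_eq hS (N + 1)
    have := h.card_le happ hρ hUz fun w hw => hTS hw
    omega
  refine ⟨hS, ?_⟩
  refine HasCount.unique (f := f) (U := U) ?_ h happ hρ hUz
  refine hasCount_of_eventually_hasCount_ball hU
    (Metric.isBounded_closedBall.subset (subset_closure.trans hUz))
    (fun x hx => (hf x hx).continuousAt.continuousWithinAt) hS (fun x hx => hx.1)
    (fun x hx h0 => ⟨?_, h0⟩) fun x hx => ?_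
  · by_contra hxU
    exact hf0 x (hU.frontier_eq ▸ ⟨hx, hxU⟩) h0
  · have hxan := hf x (subset_closure hx.1)
    refine eventually_hasCount_ball hxan hx.2 (finite_quotient_of_isolated hxan hx.2 ?_)
    have h1 : ∀ᶠ y in 𝓝 x, y ∉ S \ {x} :=
      (hS.subset Set.sdiff_subset).isClosed.isOpen_compl.mem_nhds fun hc => hc.2 rfl
    filter_upwards [h1, hU.mem_nhds hx.1] with y hy hyU h0
    by_contra hyx
    exact hy ⟨⟨hyU, h0⟩, hyx⟩

end Bounds

end PolynomialSystems

/-- Let `X` be a connected `n`-dimensional complex manifold (modeled as a connected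
open subset of `ℂ^n`), `Y` a connected `m`-dimensional complex manifold (a connected
open subset of `ℂ^m`), `f = (f_1, …, f_n)` holomorphic on `X × Y`, and suppose `x*`
is an isolated solution of `f(x, y*) = 0` of multiplicity `μ` for some `y* ∈ Y`.
Then there exist open neighborhoods `U` of `x*` and `V` of `y*` such that for every
`y' ∈ V`, the sum over all distinct points `x' ∈ U` with `f(x', y') = 0` of
`dim_ℂ O_{X,x'} / J(f_1(x, y'), …, f_n(x, y'))` equals `μ`. -/
theorem sum_of_multiplicities_is_locally_constant (n m : ℕ)
    (X : Set (Fin n → ℂ)) (Y : Set (Fin m → ℂ))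
    (hXopen : IsOpen X) (hXconn : IsConnected X)
    (hYopen : IsOpen Y) (hYconn : IsConnected Y)
    (f : (Fin n → ℂ) × (Fin m → ℂ) → Fin n → ℂ)
    (hf : ∀ p ∈ X ×ˢ Y, AnalyticAt ℂ f p)
    (xs : Fin n → ℂ) (ys : Fin m → ℂ) (hxs : xs ∈ X) (hys : ys ∈ Y)
    (hiso : ∃ O : Set (Fin n → ℂ), IsOpen O ∧ xs ∈ O ∧ O ⊆ X ∧
      {x ∈ O | f (x, ys) = 0} = {xs})
    (μ : ℕ) (hμ : μ = solMultiplicity xs (fun k x => f (x, ys) k)) :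
    ∃ U V : Set _, IsOpen U ∧ IsOpen V ∧ xs ∈ U ∧ ys ∈ V ∧ U ⊆ X ∧ V ⊆ Y ∧
      ∀ y' ∈ V,
        {x' ∈ U | f (x', y') = 0}.Finite ∧
        ∑ᶠ x' ∈ {x' ∈ U | f (x', y') = 0},
          solMultiplicity x' (fun k x => f (x, y') k) = μ := by
  obtain ⟨O, hO, hxO, hOX, hOf⟩ := hiso
  have han : ∀ x ∈ X, ∀ y ∈ Y, AnalyticAt ℂ (fun x => f (x, y)) x := fun x hx y hy =>
    AnalyticAt.comp_of_eq (hf (x, y) ⟨hx, hy⟩) (analyticAt_id.prod analyticAt_const) rfl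
  have hfO : ∀ x ∈ O, f (x, ys) = 0 → x = xs := fun x hx h0 =>
    (hOf.subset ⟨hx, h0⟩ : x ∈ ({xs} : Set _))
  have hfxs : f (xs, ys) = 0 := (hOf.superset rfl).2
  have hcount := eventually_hasCount_ball (han xs hxs ys hys) hfxs
    (finite_quotient_of_isolated (han xs hxs ys hys) hfxs
      ((hO.eventually_mem hxO).mono fun x hx h0 => hfO x hx h0))
  rw [← hμ] at hcount
  obtain ⟨p, r, hp⟩ := hf (xs, ys) ⟨hxs, hys⟩
  obtain ⟨r', hr'0, hr'⟩ := ENNReal.lt_iff_exists_nnreal_btwn.1 hp.r_pos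
  have hr'0 : 0 < (r' : ℝ) := by exact_mod_cast hr'0
  obtain ⟨b, hb, hbO⟩ := Metric.isOpen_iff.1 hO xs hxO
  have hsmall : ∀ᶠ ρ in 𝓝[>] (0 : ℝ), ρ < min (min (r' : ℝ) b) 1 :=
    mem_nhdsWithin_of_mem_nhds (Iio_mem_nhds (lt_min (lt_min hr'0 hb) one_pos))
  obtain ⟨ρ, hN, hρ, hρ0⟩ := (hcount.and (hsmall.and self_mem_nhdsWithin)).exists
  replace hρ0 : 0 < ρ := hρ0
  obtain ⟨⟨hρr, hρb⟩, hρ1⟩ := (lt_min_iff.1 hρ).imp_left lt_min_iff.1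
  have hcl : closure (Metric.ball xs ρ) ⊆ Metric.closedBall xs ρ :=
    Metric.closure_ball_subset_closedBall
  have hclO : closure (Metric.ball xs ρ) ⊆ O := fun x hx => hbO (lt_of_le_of_lt (hcl hx) hρb)
  have hcompact : IsCompact (closure (Metric.ball xs ρ)) := Metric.isBounded_ball.isCompact_closure
  have hfr : IsCompact (frontier (Metric.ball xs ρ)) :=
    hcompact.of_isClosed_subset isClosed_frontier frontier_subset_closure
  obtain ⟨δ, hδ, hδf⟩ := hfr.exists_pos_forall_le_norm (f := fun x => f (x, ys))
    (fun x hx => (han x (hOX (hclO (frontier_subset_closure hx))) ys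
      hys).continuousAt.continuousWithinAt) fun x hx h0 => by
      have h1 : dist x xs = ρ := Metric.frontier_ball_subset_sphere hx
      rw [hfO x (hclO (frontier_subset_closure hx)) h0, dist_self] at h1
      exact hρ0.ne h1
  obtain ⟨ε, hε, hεN⟩ := hN.exists_forall_close
  have hclose : ∀ᶠ y in 𝓝 ys, ∀ x ∈ closure (Metric.ball xs ρ),
      ‖f (x, y) - f (x, ys)‖ < min ε δ := by
    refine hcompact.eventually_forall_of_forall_eventually fun x hx => ?_
    have h1 : ContinuousAt f (x, ys) := (hf (x, ys) ⟨hOX (hclO hx), hys⟩).continuousAt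
    have h2 : ContinuousAt (fun q : (Fin m → ℂ) × (Fin n → ℂ) =>
        ‖f (q.2, q.1) - f (q.2, ys)‖) (ys, x) :=
      ((ContinuousAt.comp_of_eq (f := fun q : (Fin m → ℂ) × (Fin n → ℂ) => (q.2, q.1)) h1
        (by fun_prop) rfl).sub (ContinuousAt.comp_of_eq
          (f := fun q : (Fin m → ℂ) × (Fin n → ℂ) => (q.2, ys)) h1 (by fun_prop) rfl)).norm
    exact h2.eventually_lt_const (by simpa using ⟨hε, hδ⟩)
  obtain ⟨V, hV, hVo, hyV⟩ := eventually_nhds_iff.1 ((hclose.and (hYopen.eventually_mem hys)).and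
    (Metric.ball_mem_nhds ys hr'0))
  refine ⟨Metric.ball xs ρ, V, Metric.isOpen_ball, hVo, Metric.mem_ball_self hρ0, hyV,
    subset_closure.trans (hclO.trans hOX), fun y hy => (hV y hy).1.2, fun y hy => ?_⟩
  obtain ⟨⟨hyf, hyY⟩, hyr⟩ := hV y hy
  refine HasCount.finite_and_finsum_eq (f := fun x => f (x, y))
    (hεN _ fun x hx => (hyf x hx).trans_le (min_le_left _ _)) Metric.isOpen_ball
    (fun x hx => han x (hOX (hclO hx)) y hyY) (fun x hx h0 => ?_) ?_ hρ1 hcl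
  · have h1 := hyf x (frontier_subset_closure hx)
    rw [h0, zero_sub, norm_neg] at h1
    linarith [hδf x hx, min_le_right ε δ]
  · have h1 := hp.polyApproxOn hr' (LinearMap.inl ℂ (Fin n → ℂ) (Fin m → ℂ)) (0, y)
      (K := closure (Metric.ball xs ρ)) fun x hx => by
        simp only [LinearMap.inl_apply, Prod.mk_add_mk, add_zero, zero_add]
        rw [← ball_prod_same]
        exact ⟨lt_of_le_of_lt (hcl hx) hρr, hyr⟩
    simpa using h1
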